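/- Let P, Q ∈ ℝ[x₁,…,x_d] be irreducible polynomials generating real ideals, and suppose the real intersection Z(P) ∩ Z(Q) has dimension d − 2. Then the complex varieties Z(P)* ∩ Z(Q)* form a complete intersection in ℂ^d, i.e., every irreducible component of Z(P)* ∩ Z(Q)* has complex dimension d − 2. -/

import Mathlib

open MvPolynomial

variable {d : ℕ}

/-- An ideal `I ⊆ ℝ[x₁,…,x_d]` is *real* if whenever a finite sum of squares
`a₁² + ⋯ + a_ℓ²` belongs to `I`, each `a_j` belongs to `I`. -/
def IsRealIdeal (I : Ideal (MvPolynomial (Fin d) ℝ)) : Prop :=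
  ∀ (ℓ : ℕ) (a : Fin ℓ → MvPolynomial (Fin d) ℝ),
    (∑ j, a j ^ 2) ∈ I → ∀ j, a j ∈ I

/-- An (affine) algebraic variety over `K`. -/
def IsVariety (K : Type*) [CommRing K] (V : Set (Fin d → K)) : Prop :=
  ∃ F : Set (MvPolynomial (Fin d) K), V = {x | ∀ f ∈ F, eval x f = 0}

/-- The smallest variety over `K` containing a set `A` (its Zariski closure). -/
def varietyClosure (K : Type*) [CommRing K] (A : Set (Fin d → K)) : Set (Fin d → K) :=
  {x | ∀ f : MvPolynomial (Fin d) K, (∀ a ∈ A, eval a f = 0) → eval x f = 0}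

/-- An irreducible variety. -/
def IsIrreducibleVariety (K : Type*) [CommRing K] (V : Set (Fin d → K)) : Prop :=
  IsVariety K V ∧ V.Nonempty ∧
    ∀ V₁ V₂ : Set (Fin d → K), IsVariety K V₁ → IsVariety K V₂ →
      V ⊆ V₁ ∪ V₂ → V ⊆ V₁ ∨ V ⊆ V₂

/-- `W` is an irreducible component of `V`: a maximal irreducible subvariety. -/
def IsIrreducibleComponent (K : Type*) [CommRing K] (V W : Set (Fin d → K)) : Prop :=
  IsIrreducibleVariety K W ∧ W ⊆ V ∧
    ∀ W' : Set (Fin d → K), IsIrreducibleVariety K W' → W ⊆ W' → W' ⊆ V → W' = W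

/-- The canonical embedding `ℝ^d ↪ ℂ^d`. -/
def realToComplex (x : Fin d → ℝ) : Fin d → ℂ := fun i => (x i : ℂ)

/-- The complexification `Z*` of a real set `Z ⊆ ℝ^d`. -/
def complexification (Z : Set (Fin d → ℝ)) : Set (Fin d → ℂ) :=
  varietyClosure ℂ (realToComplex '' Z)

section

open MvPolynomial

open Polynomial in
/-- A field in which `-1` is not a sum of squares and each element is a square up to sign
carries a linear order. -/
theorem exists_linearOrder_of_isSquare_or_neg (F : Type*) [Field F] [IsSemireal F]
    (h : ∀ x : F, IsSumSq x ∨ IsSumSq (-x)) :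
    ∃ _ : LinearOrder F, IsStrictOrderedRing F := by
  classical
  have hz : ∀ {a : F}, IsSumSq a → IsSumSq (-a) → a = 0 := by
    intro a ha hna
    by_contra h0
    apply IsSemireal.not_isSumSq_neg_one F
    have h1 : (-1 : F) = -a * a * (a⁻¹ * a⁻¹) := by field_simp
    rw [h1]
    exact (hna.mul ha).mul (IsSumSq.mul_self _)
  let C : RingCone F :=
    { carrier := {x | IsSumSq x}
      mul_mem' := fun ha hb => IsSumSq.mul ha hb
      one_mem' := by simp
      add_mem' := fun ha hb => IsSumSq.add ha hb
      zero_mem' := IsSumSq.zero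
      eq_zero_of_mem_of_neg_mem' := fun ha hb => hz ha hb }
  have : HasMemOrNegMem C := ⟨fun x => h x⟩
  let _ : LinearOrder F := LinearOrder.mkOfAddGroupCone C
  have : IsOrderedRing F := IsOrderedRing.mkOfCone C
  exact ⟨inferInstance, IsOrderedRing.toIsStrictOrderedRing F⟩

end

section

open Polynomial

theorem isSumSq_map {A B : Type*} [Semiring A] [Semiring B] (φ : A →+* B) {a : A}
    (h : IsSumSq a) : IsSumSq (φ a) := by
  induction h with
  | zero => simp
  | sq_add x _ ih => 
    rw [map_add, map_mul]
    exact IsSumSq.sq_add _ ih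

theorem IsSemireal.of_ringHom {A B : Type*} [Field A] [Field B] (φ : A →+* B)
    [IsSemireal B] : IsSemireal A := by
  rw [isSemireal_iff_not_isSumSq_neg_one]
  intro h
  apply IsSemireal.not_isSumSq_neg_one B
  simpa using isSumSq_map φ h

/-- A semireal field has an algebraic semireal extension that is maximal among such. -/
theorem exists_maximal_semireal_extension (K : Type*) [Field K] [IsSemireal K] :
    ∃ E : IntermediateField K (AlgebraicClosure K), IsSemireal E ∧
      ∀ E' : IntermediateField K (AlgebraicClosure K), IsSemireal E' → E ≤ E' → E' = E := by
  have key : ∃ m, Maximal (· ∈ {E : IntermediateField K (AlgebraicClosure K) | IsSemireal E}) m := by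
    apply zorn_le₀
    intro c hc hchain
    rcases c.eq_empty_or_nonempty with rfl | hne
    · refine ⟨⊥, ?_, by simp⟩
      have : IsSemireal K := inferInstance
      exact IsSemireal.of_ringHom
        (IntermediateField.botEquiv K (AlgebraicClosure K)).toRingEquiv.toRingHom
    · have hn : Nonempty c := hne.to_subtype
      refine ⟨sSup c, ?_, fun E hE => le_sSup hE⟩
      have hmem : ∀ x : AlgebraicClosure K, x ∈ sSup c → ∃ E ∈ c, x ∈ E := by
        have := IntermediateField.coe_iSup_of_directed (L := AlgebraicClosure K)
          (t := fun E : c => (E : IntermediateField K (AlgebraicClosure K)))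
        have h2 := this (by simpa using hchain.directedOn.directed_val)
        intro x hx
        rw [sSup_eq_iSup', ← SetLike.mem_coe, h2] at hx
        obtain ⟨E, hE⟩ := Set.mem_iUnion.1 hx
        exact ⟨E, E.2, hE⟩
      change IsSemireal _
      rw [isSemireal_iff_not_isSumSq_neg_one]
      have h3 : ∀ s : (sSup c : IntermediateField K (AlgebraicClosure K)), IsSumSq s →
          ∃ E ∈ c, ∃ t : E, IsSumSq t ∧ (t : AlgebraicClosure K) = s := by
        intro s hs
        induction hs with
        | zero =>
          obtain ⟨E, hE⟩ := hne
          exact ⟨E, hE, 0, IsSumSq.zero, by simp⟩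
        | sq_add x _ ih =>
          obtain ⟨E, hE, t, ht, hts⟩ := ih
          obtain ⟨E', hE', hx⟩ := hmem x x.2
          obtain ⟨E'', hE'', hl, hl'⟩ := hchain.directedOn E hE E' hE'
          refine ⟨E'', hE'', ⟨x, hl' hx⟩ * ⟨x, hl' hx⟩ + IntermediateField.inclusion hl t,
            IsSumSq.sq_add _ (isSumSq_map (IntermediateField.inclusion hl).toRingHom ht), ?_⟩
          simp [hts]
      intro h
      obtain ⟨E, hE, t, ht, hts⟩ := h3 _ h
      have h4 : IsSemireal E := hc hE
      apply IsSemireal.not_isSumSq_neg_one E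
      have h5 : (-1 : E) = t := by
        apply Subtype.ext
        simpa using hts.symm
      rwa [h5]
  obtain ⟨E, hE⟩ := key
  exact ⟨E, hE.prop, fun E' h hle => le_antisymm (hE.2 h hle) hle⟩

theorem exists_semireal_extension_adjoinRoot (K : Type*) [Field K] [IsSemireal K] :
    ∃ E : IntermediateField K (AlgebraicClosure K), IsSemireal E ∧
      ∀ f : E[X], Irreducible f → 2 ≤ f.natDegree → IsSumSq (-1 : AdjoinRoot f) := by
  obtain ⟨E, hE, hmax⟩ := exists_maximal_semireal_extension K
  refine ⟨E, hE, fun f hf hdeg => ?_⟩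
  by_contra hs
  have : Fact (Irreducible f) := ⟨hf⟩
  have hsr : IsSemireal (AdjoinRoot f) := isSemireal_iff_not_isSumSq_neg_one.2 hs
  obtain ⟨z, hz⟩ := IsAlgClosed.exists_aeval_eq_zero (AlgebraicClosure K) f
    (by rw [Polynomial.degree_eq_natDegree hf.ne_zero]; norm_cast; omega)
  let φ : AdjoinRoot f →ₐ[E] AlgebraicClosure K := AdjoinRoot.liftAlgHom f (Algebra.ofId _ _) z hz
  have h1 : IsSemireal (φ.fieldRange.restrictScalars K) := by
    have e := (AlgEquiv.ofInjectiveField φ).symm.toRingEquiv.toRingHom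
    exact IsSemireal.of_ringHom (A := φ.fieldRange) e
  have h2 := hmax _ h1 (by
    intro x hx
    change x ∈ φ.fieldRange
    exact ⟨algebraMap E _ ⟨x, hx⟩, φ.commutes _⟩)
  have h3 : z ∈ E := by
    rw [← h2]
    change z ∈ φ.fieldRange
    exact ⟨AdjoinRoot.root f, AdjoinRoot.liftAlgHom_root ..⟩
  have h4 : f.IsRoot ⟨z, h3⟩ := by
    have : algebraMap E (AlgebraicClosure K) (f.eval ⟨z, h3⟩) = 0 := by
      rw [← hz, ← Polynomial.aeval_algebraMap_apply_eq_algebraMap_eval]; rfl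
    exact (map_eq_zero _).1 this
  have h5 : f.natDegree = 1 := Polynomial.natDegree_eq_of_degree_eq_some
    (Polynomial.degree_eq_one_of_irreducible_of_root hf h4)
  omega

end

section

open Polynomial

theorem isSumSq_adjoinRoot_sqrt {F : Type*} [Field F] (a : F) {s : AdjoinRoot (Polynomial.X ^ 2 - Polynomial.C a)}
    (hs : IsSumSq s) : ∃ p q r : F, IsSumSq p ∧ IsSumSq q ∧
      s = AdjoinRoot.of _ (p + a * q) + AdjoinRoot.of _ r * AdjoinRoot.root _ := by
  have hroot : (AdjoinRoot.root (Polynomial.X ^ 2 - Polynomial.C a)) ^ 2 = AdjoinRoot.of _ a := by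
    have := AdjoinRoot.eval₂_root (Polynomial.X ^ 2 - Polynomial.C a)
    simpa [sub_eq_zero] using this
  have hdeg : (Polynomial.X ^ 2 - Polynomial.C a).natDegree = 2 := natDegree_X_pow_sub_C
  have hmon : (Polynomial.X ^ 2 - Polynomial.C a).Monic := monic_X_pow_sub_C a (by norm_num)
  induction hs with
  | zero => exact ⟨0, 0, 0, IsSumSq.zero, IsSumSq.zero, by simp⟩
  | sq_add x _ ih =>
    obtain ⟨p, q, r, hp, hq, rfl⟩ := ih
    obtain ⟨b, c, rfl⟩ : ∃ b c : F, x = AdjoinRoot.of _ b +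
        AdjoinRoot.of _ c * AdjoinRoot.root _ := by
      obtain ⟨g, rfl⟩ := AdjoinRoot.mk_surjective x
      have h1 : AdjoinRoot.mk (Polynomial.X ^ 2 - Polynomial.C a) g = AdjoinRoot.mk _ (g %ₘ (Polynomial.X ^ 2 - Polynomial.C a)) := by
        conv_lhs => rw [← modByMonic_add_div g (Polynomial.X ^ 2 - Polynomial.C a)]
        simp
      have h2 : (g %ₘ (Polynomial.X ^ 2 - Polynomial.C a)).natDegree ≤ 1 := by
        have := natDegree_modByMonic_lt g hmon (by
          intro h; rw [h] at hdeg; simp at hdeg)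
        omega
      obtain ⟨c, b, h3⟩ := exists_eq_X_add_C_of_natDegree_le_one h2
      refine ⟨b, c, ?_⟩
      rw [h1, h3]
      simp [add_comm]
    refine ⟨b * b + p, c * c + q, 2 * b * c + r, IsSumSq.sq_add _ hp, IsSumSq.sq_add _ hq, ?_⟩
    simp only [map_add, map_mul, ← hroot, map_ofNat]
    ring

theorem isSumSq_neg_of_not_isSquare {F : Type*} [Field F] [IsSemireal F]
    (h : ∀ f : F[X], Irreducible f → 2 ≤ f.natDegree → IsSumSq (-1 : AdjoinRoot f))
    {a : F} (ha : ¬ IsSquare a) : IsSumSq (-a) := by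
  have hdeg : (Polynomial.X ^ 2 - Polynomial.C a).natDegree = 2 := natDegree_X_pow_sub_C
  have hirr : Irreducible (Polynomial.X ^ 2 - Polynomial.C a) := by
    rw [irreducible_iff_roots_eq_zero_of_degree_le_three (by omega) (by omega)]
    rw [Multiset.eq_zero_iff_forall_notMem]
    intro b hb
    have := (mem_roots'.1 hb).2
    apply ha
    refine ⟨b, ?_⟩
    simp [sub_eq_zero] at this
    rw [← this]; ring
  obtain ⟨p, q, r, hp, hq, hs⟩ := isSumSq_adjoinRoot_sqrt a (h _ hirr (by omega))
  have h1 : AdjoinRoot.mk (Polynomial.X ^ 2 - Polynomial.C a) (Polynomial.C r * Polynomial.X + Polynomial.C (p + a * q + 1)) = 0 := by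
    have h2 : AdjoinRoot.mk (Polynomial.X ^ 2 - Polynomial.C a) (Polynomial.C r * Polynomial.X + Polynomial.C (p + a * q + 1)) =
      AdjoinRoot.of _ (p + a * q) + AdjoinRoot.of _ r * AdjoinRoot.root _ + 1 := by
      simp; ring
    rw [h2, ← hs]; ring
  rw [AdjoinRoot.mk_eq_zero] at h1
  have h0 : Polynomial.C r * Polynomial.X + Polynomial.C (p + a * q + 1) = 0 := by
    by_contra h0
    have := natDegree_le_of_dvd h1 h0
    have := natDegree_linear_le (a := r) (b := p + a * q + 1)
    omega
  have h3 : p + a * q + 1 = 0 := by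
    have := congrArg (Polynomial.coeff · 0) h0
    simpa using this
  have hq0 : q ≠ 0 := by
    rintro rfl
    apply IsSemireal.one_add_ne_zero hp
    linear_combination h3
  have : -a = (1 + p) * q * (q⁻¹ * q⁻¹) := by
    field_simp
    linear_combination -h3
  rw [this]
  exact ((IsSumSq.one.add hp).mul hq).mul (IsSumSq.mul_self _)

theorem isSquare_of_isSumSq {F : Type*} [Field F] [IsSemireal F]
    (h : ∀ f : F[X], Irreducible f → 2 ≤ f.natDegree → IsSumSq (-1 : AdjoinRoot f))
    {a : F} (ha : IsSumSq a) : IsSquare a := by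
  by_contra hna
  have h1 := isSumSq_neg_of_not_isSquare h hna
  have ha0 : a ≠ 0 := by rintro rfl; exact hna IsSquare.zero
  apply IsSemireal.not_isSumSq_neg_one F
  have h1 : (-1 : F) = -a * a * (a⁻¹ * a⁻¹) := by field_simp
  rw [h1]
  exact (IsSumSq.mul ‹_› ha).mul (IsSumSq.mul_self _)

/-- The shape of a sum of squares of polynomials of degree less than `n`. -/
def IsPosEvenLt {F : Type*} [Field F] [LinearOrder F] (n : ℕ) (f : F[X]) : Prop :=
  0 < f.leadingCoeff ∧ Even f.natDegree ∧ f.natDegree + 1 < 2 * n ∧ ∀ x, 0 ≤ f.eval x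

theorem IsPosEvenLt.add {F : Type*} [Field F] [LinearOrder F] [IsStrictOrderedRing F] {n : ℕ}
    {f g : F[X]} (hf : IsPosEvenLt n f) (hg : IsPosEvenLt n g) : IsPosEvenLt n (f + g) := by
  have aux : ∀ f g : F[X], IsPosEvenLt n f → IsPosEvenLt n g → f.natDegree < g.natDegree →
      IsPosEvenLt n (f + g) := by
    intro f g hf hg h
    have hd : f.degree < g.degree := degree_lt_degree h
    exact ⟨by rw [leadingCoeff_add_of_degree_lt hd]; exact hg.1,
      by rw [natDegree_add_eq_right_of_natDegree_lt h]; exact hg.2.1,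
      by rw [natDegree_add_eq_right_of_natDegree_lt h]; exact hg.2.2.1,
      fun x => by rw [Polynomial.eval_add]; exact add_nonneg (hf.2.2.2 x) (hg.2.2.2 x)⟩
  rcases lt_trichotomy f.natDegree g.natDegree with h | h | h
  · exact aux f g hf hg h
  · have hpos : 0 < f.leadingCoeff + g.leadingCoeff := add_pos hf.1 hg.1
    have hc : (f + g).coeff f.natDegree = f.leadingCoeff + g.leadingCoeff := by
      rw [Polynomial.coeff_add, leadingCoeff, leadingCoeff, h]
    have hd : (f + g).natDegree = f.natDegree := by
      apply le_antisymm
      · exact (natDegree_add_le _ _).trans (by simp [h])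
      · exact le_natDegree_of_ne_zero (by rw [hc]; exact hpos.ne')
    refine ⟨?_, by rw [hd]; exact hf.2.1, by rw [hd]; exact hf.2.2.1,
      fun x => by rw [Polynomial.eval_add]; exact add_nonneg (hf.2.2.2 x) (hg.2.2.2 x)⟩
    rw [leadingCoeff, hd, hc]; exact hpos
  · rw [add_comm]; exact aux g f hg hf h

theorem exists_isPosEvenLt_of_isSumSq {F : Type*} [Field F] [LinearOrder F] [IsStrictOrderedRing F]
    {f : F[X]} (hf : Irreducible f) {s : AdjoinRoot f} (hs : IsSumSq s) :
    ∃ g : F[X], AdjoinRoot.mk f g = s ∧ (g = 0 ∨ IsPosEvenLt f.natDegree g) := by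
  induction hs with
  | zero => exact ⟨0, by simp, Or.inl rfl⟩
  | sq_add x _ ih =>
    obtain ⟨g, rfl, hg⟩ := ih
    obtain ⟨p, rfl⟩ := AdjoinRoot.mk_surjective x
    have h1 : AdjoinRoot.mk f p = AdjoinRoot.mk f (p % f) := by
      conv_lhs => rw [← EuclideanDomain.mod_add_div p f]
      simp
    refine ⟨(p % f) * (p % f) + g, by simp [h1], ?_⟩
    by_cases h0 : p % f = 0
    · simpa [h0] using hg
    right
    have h2 : IsPosEvenLt f.natDegree ((p % f) * (p % f)) := by
      have h3 := natDegree_mod_lt p (q := f) hf.natDegree_pos.ne'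
      have h4 : p % f ≠ 0 := h0
      refine ⟨?_, ?_, ?_, fun x => by rw [Polynomial.eval_mul]; exact mul_self_nonneg _⟩
      · rw [leadingCoeff_mul]
        exact mul_self_pos.2 (leadingCoeff_ne_zero.2 h4)
      · rw [natDegree_mul h4 h4]; simp
      · rw [natDegree_mul h4 h4]; omega
    rcases hg with rfl | hg
    · simpa using h2
    · exact h2.add hg

theorem exists_isRoot_of_odd {F : Type*} [Field F] [LinearOrder F] [IsStrictOrderedRing F]
    (h : ∀ f : F[X], Irreducible f → 2 ≤ f.natDegree → IsSumSq (-1 : AdjoinRoot f))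
    (n : ℕ) (f : F[X]) (hn : f.natDegree = n) (hodd : Odd n) : ∃ x, f.IsRoot x := by
  induction n using Nat.strong_induction_on generalizing f with
  | h n ih =>
  have hf0 : f ≠ 0 := by rintro rfl; simp at hn; subst hn; simp at hodd
  by_cases hirr : Irreducible f
  · by_cases hn1 : n = 1
    · exact exists_root_of_degree_eq_one (by rw [degree_eq_natDegree hf0, hn, hn1]; rfl)
    obtain ⟨m, hm⟩ := hodd
    obtain ⟨g, hg, hg'⟩ := exists_isPosEvenLt_of_isSumSq hirr (h f hirr (by omega))
    have h1 : IsPosEvenLt f.natDegree (1 : F[X]) := ⟨by simp, by simp, by simp; omega, by simp⟩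
    have h2 : IsPosEvenLt f.natDegree (g + 1) := by
      rcases hg' with rfl | hg'
      · simpa using h1
      · exact hg'.add h1
    have h3 : f ∣ g + 1 := by
      rw [← AdjoinRoot.mk_eq_zero]; simp [hg]
    obtain ⟨q, hq⟩ := h3
    have hg1 : g + 1 ≠ 0 := by
      intro h0; have := h2.1; rw [h0] at this; simp at this
    have hq0 : q ≠ 0 := by rintro rfl; simp at hq; exact hg1 hq
    have h4 : (g + 1).natDegree = n + q.natDegree := by rw [hq, natDegree_mul hf0 hq0, hn]
    obtain ⟨-, ⟨l, hl⟩, h6, -⟩ := h2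
    obtain ⟨x, hx⟩ := ih q.natDegree (by omega) q rfl ⟨l - m - 1, by omega⟩
    exfalso
    have h7 : 0 ≤ g.eval x := by
      rcases hg' with rfl | hg'
      · simp
      · exact hg'.2.2.2 x
    have := congrArg (eval x) hq
    rw [Polynomial.eval_mul, hx.eq_zero, Polynomial.eval_add, eval_one] at this
    linarith
  · have hu : ¬ IsUnit f := by
      intro hu; rw [natDegree_eq_zero_of_isUnit hu] at hn; subst hn; simp at hodd
    obtain ⟨p, q, hp, hq, hpq⟩ : ∃ p q, ¬ IsUnit p ∧ ¬ IsUnit q ∧ f = p * q := by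
      by_contra hcon
      push Not at hcon
      apply hirr
      refine ⟨hu, fun a b hab => ?_⟩
      by_contra hab'
      push Not at hab'
      exact hcon a b hab'.1 hab'.2 hab
    have hp0 : p ≠ 0 := by rintro rfl; simp at hpq; exact hf0 hpq
    have hq0 : q ≠ 0 := by rintro rfl; simp at hpq; exact hf0 hpq
    have hd : n = p.natDegree + q.natDegree := by rw [← hn, hpq, natDegree_mul hp0 hq0]
    have hp1 : p.natDegree ≠ 0 := fun h0 => hp (by
      rw [eq_C_of_natDegree_eq_zero h0, isUnit_C, isUnit_iff_ne_zero]
      rintro h1; rw [eq_C_of_natDegree_eq_zero h0, h1] at hp0; simp at hp0)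
    have hq1 : q.natDegree ≠ 0 := fun h0 => hq (by
      rw [eq_C_of_natDegree_eq_zero h0, isUnit_C, isUnit_iff_ne_zero]
      rintro h1; rw [eq_C_of_natDegree_eq_zero h0, h1] at hq0; simp at hq0)
    rw [hd, Nat.odd_add] at hodd
    by_cases hpo : Odd p.natDegree
    · obtain ⟨x, hx⟩ := ih _ (by omega) p rfl hpo
      exact ⟨x, by rw [hpq]; exact root_mul_right_of_isRoot q hx⟩
    · have : Odd q.natDegree := by
        rw [← Nat.not_even_iff_odd]; exact fun he => hpo (hodd.2 he)
      obtain ⟨x, hx⟩ := ih _ (by omega) q rfl this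
      exact ⟨x, by rw [hpq]; exact root_mul_left_of_isRoot p hx⟩

/-- A semireal field embeds into an ordered real closed field. -/
theorem exists_isRealClosed_extension (K : Type*) [Field K] [IsSemireal K] :
    ∃ E : IntermediateField K (AlgebraicClosure K), ∃ _ : LinearOrder E,
      IsStrictOrderedRing E ∧ IsRealClosed E := by
  obtain ⟨E, hE, h⟩ := exists_semireal_extension_adjoinRoot K
  obtain ⟨i1, i2⟩ := exists_linearOrder_of_isSquare_or_neg E (fun x => by
    by_cases hx : IsSquare x
    · exact Or.inl hx.isSumSq
    · exact Or.inr (isSumSq_neg_of_not_isSquare h hx))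
  refine ⟨E, i1, i2, { hE with
    isSquare_or_isSquare_neg := fun x => ?_
    exists_isRoot_of_odd_natDegree := fun {f} hf => exists_isRoot_of_odd h _ f rfl hf }⟩
  by_cases hx : IsSquare x
  · exact Or.inl hx
  · exact Or.inr (isSquare_of_isSumSq h (isSumSq_neg_of_not_isSquare h hx))

end

section

open Polynomial IntermediateField Module

section
variable {R : Type*} [Field R] [LinearOrder R] [IsStrictOrderedRing R] [IsRealClosed R]

theorem exists_sqrt_add_mul_I {A : Type*} [CommRing A] [Algebra R A] {I : A} (hI : I ^ 2 = -1)
    (a b : R) : ∃ c d : R, (algebraMap R A c + algebraMap R A d * I) ^ 2 =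
      algebraMap R A a + algebraMap R A b * I := by
  have hsq : ∀ x : R, 0 ≤ x → ∃ y, 0 ≤ y ∧ y * y = x := by
    intro x hx
    obtain ⟨y, hy⟩ := IsRealClosed.nonneg_iff_isSquare.1 hx
    exact ⟨|y|, abs_nonneg _, by rw [abs_mul_abs_self, hy]⟩
  obtain ⟨r, hr0, hr⟩ := hsq (a * a + b * b) (by nlinarith [mul_self_nonneg a, mul_self_nonneg b])
  have hra : |a| ≤ r := abs_le_of_sq_le_sq (by nlinarith [mul_self_nonneg b]) hr0
  obtain ⟨h1, h2⟩ := abs_le.1 hra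
  obtain ⟨c, hc0, hc⟩ := hsq ((r + a) / 2) (by linarith)
  obtain ⟨d, hd0, hd⟩ := hsq ((r - a) / 2) (by linarith)
  have hcd : (2 * c * d) ^ 2 = b ^ 2 := by
    have : (2 * c * d) ^ 2 = 4 * (c * c) * (d * d) := by ring
    rw [this, hc, hd]
    linear_combination hr
  have key : ∀ d' : R, d' * d' = d * d → 2 * c * d' = b →
      (algebraMap R A c + algebraMap R A d' * I) ^ 2 = algebraMap R A a + algebraMap R A b * I := by
    intro d' h h'
    have h3 : c * c - d' * d' = a := by rw [h, hc, hd]; ring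
    rw [← h3, ← h']
    simp only [map_sub, map_mul, map_ofNat]
    linear_combination (algebraMap R A d') ^ 2 * hI
  rcases sq_eq_sq_iff_eq_or_eq_neg.1 hcd with h | h
  · exact ⟨c, d, key d rfl h⟩
  · exact ⟨c, -d, key (-d) (by ring) (by linear_combination -h)⟩

omit [LinearOrder R] [IsStrictOrderedRing R] in
theorem finrank_eq_one_of_odd {K : Type*} [Field K] [Algebra R K] [FiniteDimensional R K]
    (h : Odd (finrank R K)) : finrank R K = 1 := by
  obtain ⟨α, hα⟩ := Field.exists_primitive_element R K
  have hintegral : IsIntegral R α := Algebra.IsIntegral.isIntegral α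
  have h1 : (minpoly R α).natDegree = finrank R K := by
    rw [← adjoin.finrank hintegral, hα, finrank_top']
  obtain ⟨x, hx⟩ := IsRealClosed.exists_isRoot_of_odd_natDegree (f := minpoly R α) (by rwa [h1])
  rw [← h1]
  exact natDegree_eq_of_degree_eq_some
    (degree_eq_one_of_irreducible_of_root (minpoly.irreducible hintegral) hx)

theorem exists_add_mul_I_of_isGalois {N : Type*} [Field N] [Algebra R N] [FiniteDimensional R N]
    [IsGalois R N] {I : N} (hI : I ^ 2 = -1) (z : N) :
    ∃ a b : R, z = algebraMap R N a + algebraMap R N b * I := by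
  have hF : ∀ x ∈ R⟮I⟯, ∃ a b : R, x = algebraMap R N a + algebraMap R N b * I := by
    intro x hx
    rw [← mem_toSubalgebra, adjoin_simple_toSubalgebra_of_isAlgebraic
      (Algebra.IsAlgebraic.isAlgebraic I)] at hx
    induction hx using Algebra.adjoin_induction with
    | mem x hx => exact ⟨0, 1, by simpa using hx⟩
    | algebraMap r => exact ⟨r, 0, by simp⟩
    | add x y _ _ hx hy =>
      obtain ⟨a, b, rfl⟩ := hx
      obtain ⟨c, d, rfl⟩ := hy
      exact ⟨a + c, b + d, by simp only [map_add]; ring⟩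
    | mul x y _ _ hx hy =>
      obtain ⟨a, b, rfl⟩ := hx
      obtain ⟨c, d, rfl⟩ := hy
      refine ⟨a * c - b * d, a * d + b * c, ?_⟩
      simp only [map_add, map_mul, map_sub]
      linear_combination (algebraMap R N b * algebraMap R N d) * hI
  obtain ⟨k, m, hm, hkm⟩ := Nat.exists_eq_two_pow_mul_odd (n := finrank R N) finrank_pos.ne'
  have hm1 : m = 1 := by
    obtain ⟨H, hH⟩ := Sylow.exists_subgroup_card_pow_prime (G := Gal(N/R)) 2 (n := k)
      (by rw [IsGalois.card_aut_eq_finrank, hkm]; exact dvd_mul_right _ _)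
    have h1 := finrank_fixedField_eq_card H
    have h2 := finrank_mul_finrank R (fixedField H) N
    rw [h1, hH, hkm, mul_comm] at h2
    have h3 : finrank R (fixedField H) = m := Nat.eq_of_mul_eq_mul_left (by positivity) h2
    rw [← h3]
    exact finrank_eq_one_of_odd (by rw [h3]; exact hm)
  rw [hm1, mul_one] at hkm
  obtain ⟨j, hj, hj'⟩ : ∃ j ≤ k, finrank R⟮I⟯ N = 2 ^ j :=
    (Nat.dvd_prime_pow Nat.prime_two).1 (by
      rw [← hkm, ← finrank_mul_finrank R R⟮I⟯ N]; exact dvd_mul_left _ _)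
  rcases Nat.eq_zero_or_pos j with rfl | hjpos
  · rw [pow_zero] at hj'
    have := finrank_eq_one_iff_eq_top.1 hj'
    exact hF z (by rw [this]; trivial)
  · exfalso
    obtain ⟨H, hH⟩ := Sylow.exists_subgroup_card_pow_prime (G := Gal(N/R⟮I⟯)) 2 (n := j - 1)
      (by rw [IsGalois.card_aut_eq_finrank, hj']; exact pow_dvd_pow _ (by omega))
    have h1 := finrank_fixedField_eq_card H
    have h2 := finrank_mul_finrank R⟮I⟯ (fixedField H) N
    rw [h1, hH, hj'] at h2
    have h3 : finrank R⟮I⟯ (fixedField H) = 2 := by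
      have h4 : 2 ^ j = 2 * 2 ^ (j - 1) := by rw [← pow_succ']; congr 1; omega
      rw [h4] at h2
      exact Nat.eq_of_mul_eq_mul_right (by positivity) h2
    obtain ⟨w, hw⟩ := Field.exists_primitive_element R⟮I⟯ (fixedField H)
    have hintegral : IsIntegral R⟮I⟯ w := Algebra.IsIntegral.isIntegral w
    have h5 : (minpoly R⟮I⟯ w).natDegree = 2 := by
      rw [← adjoin.finrank hintegral, hw, finrank_top', h3]
    have hirr := minpoly.irreducible hintegral
    rw [(minpoly.monic hintegral).irreducible_iff_roots_eq_zero_of_degree_le_three (by omega) (by omega),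
      Multiset.eq_zero_iff_forall_notMem] at hirr
    set p := minpoly R⟮I⟯ w with hp
    obtain ⟨u, v, hform⟩ : ∃ u v, p = Polynomial.X ^ 2 + Polynomial.C u * Polynomial.X + Polynomial.C v := by
      refine ⟨p.coeff 1, p.coeff 0, ?_⟩
      have := p.as_sum_range_C_mul_X_pow
      rw [h5, Finset.sum_range_succ, Finset.sum_range_succ, Finset.sum_range_one] at this
      have hl : p.coeff 2 = 1 := by rw [← h5]; exact minpoly.monic hintegral
      rw [hl] at this
      rw [this]
      simp only [map_one, pow_zero, pow_one, Polynomial.coeff_add, Polynomial.coeff_C_mul]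
      simp [Polynomial.coeff_X, Polynomial.coeff_one]
      ring
    obtain ⟨s, hs⟩ : ∃ s : R⟮I⟯, s ^ 2 = (u / 2) ^ 2 - v := by
      obtain ⟨a, b, hab⟩ := hF ((u / 2) ^ 2 - v : R⟮I⟯) (Subtype.prop _)
      obtain ⟨c, d, hcd⟩ := exists_sqrt_add_mul_I hI a b
      refine ⟨⟨algebraMap R N c + algebraMap R N d * I, ?_⟩, Subtype.ext ?_⟩
      · exact add_mem (IntermediateField.algebraMap_mem _ _) (mul_mem (IntermediateField.algebraMap_mem _ _) (mem_adjoin_simple_self R I))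
      · rw [hab, ← hcd]; rfl
    refine hirr (s - u / 2) ((mem_roots (minpoly.ne_zero hintegral)).2 ?_)
    rw [IsRoot, ← hp, hform]
    simp only [Polynomial.eval_add, Polynomial.eval_pow, Polynomial.eval_X, Polynomial.eval_mul, Polynomial.eval_C]
    linear_combination hs

/-- Each element of an algebraic field extension of a real closed field is of the form
`a + b * I`. -/
theorem exists_add_mul_I {I : AlgebraicClosure R} (hI : I ^ 2 = -1) (z : AlgebraicClosure R) :
    ∃ a b : R, z = algebraMap R _ a + algebraMap R _ b * I := by
  set p : R[X] := minpoly R z * (Polynomial.X ^ 2 + 1) with hp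
  have hintegral : IsIntegral R z := Algebra.IsIntegral.isIntegral z
  have hp0 : p ≠ 0 := by
    refine mul_ne_zero (minpoly.ne_zero hintegral) ?_
    exact (monic_X_pow_add_C (1 : R) two_ne_zero).ne_zero
  let N : IntermediateField R (AlgebraicClosure R) :=
    adjoin R (p.rootSet (AlgebraicClosure R))
  have : p.IsSplittingField R N := adjoin_rootSet_isSplittingField (IsAlgClosed.splits _)
  have : FiniteDimensional R N := Polynomial.IsSplittingField.finiteDimensional N p
  have : Normal R N := Normal.of_isSplittingField p
  have : IsGalois R N := { }
  have hzN : z ∈ N := subset_adjoin _ _ (by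
    rw [mem_rootSet]; exact ⟨hp0, by simp [hp]⟩)
  have hIN : I ∈ N := subset_adjoin _ _ (by
    rw [mem_rootSet]; exact ⟨hp0, by simp [hp, hI]⟩)
  obtain ⟨a, b, hab⟩ := exists_add_mul_I_of_isGalois (R := R) (N := N) (I := ⟨I, hIN⟩)
    (Subtype.ext (by simpa using hI)) ⟨z, hzN⟩
  exact ⟨a, b, congrArg Subtype.val hab⟩
end

end

section

open Polynomial IntermediateField Module

section
variable {R : Type*} [Field R] [LinearOrder R] [IsStrictOrderedRing R] [IsRealClosed R]

theorem exists_I (R : Type*) [Field R] : ∃ I : AlgebraicClosure R, I ^ 2 = -1 := by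
  obtain ⟨I, hI⟩ := IsAlgClosed.exists_pow_nat_eq (-1 : AlgebraicClosure R) (n := 2) (by norm_num)
  exact ⟨I, hI⟩

/-- Nonconstant polynomials over a real closed field have a factor of degree one or a positive
definite quadratic factor. -/
theorem exists_factor_of_isRealClosed {f : R[X]} (hf : 0 < f.natDegree) :
    (∃ r, Polynomial.X - Polynomial.C r ∣ f) ∨ ∃ p q : R, q ≠ 0 ∧ (Polynomial.X - Polynomial.C p) ^ 2 + Polynomial.C (q ^ 2) ∣ f := by
  have hf0 : f ≠ 0 := by rintro rfl; simp at hf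
  obtain ⟨I, hI⟩ := exists_I R
  obtain ⟨z, hz⟩ := IsAlgClosed.exists_aeval_eq_zero (AlgebraicClosure R) f
    (by rw [degree_eq_natDegree hf0]; exact_mod_cast hf.ne')
  obtain ⟨p, q, rfl⟩ := exists_add_mul_I hI z
  by_cases hq : q = 0
  · left
    refine ⟨p, dvd_iff_isRoot.2 ?_⟩
    rw [hq, map_zero, zero_mul, add_zero, Polynomial.aeval_algebraMap_apply] at hz
    exact (map_eq_zero _).1 hz
  · right
    refine ⟨p, q, hq, ?_⟩
    set z := algebraMap R (AlgebraicClosure R) p + algebraMap R _ q * I with hzdef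
    have hintegral : IsIntegral R z := Algebra.IsIntegral.isIntegral z
    have h1 : (minpoly R z) ∣ (Polynomial.X - Polynomial.C p) ^ 2 + Polynomial.C (q ^ 2) := by
      apply minpoly.dvd
      simp only [map_add, map_pow, map_sub, Polynomial.aeval_X, Polynomial.aeval_C, hzdef]
      linear_combination (algebraMap R (AlgebraicClosure R) q) ^ 2 * hI
    have hmon : ((Polynomial.X - Polynomial.C p) ^ 2 + Polynomial.C (q ^ 2)).Monic := by
      apply ((monic_X_sub_C p).pow 2).add_of_left
      rw [degree_pow, degree_X_sub_C]
      exact lt_of_le_of_lt degree_C_le (by norm_num)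
    have hdeg : ((Polynomial.X - Polynomial.C p) ^ 2 + Polynomial.C (q ^ 2)).natDegree = 2 := by
      rw [natDegree_add_C, natDegree_pow, natDegree_X_sub_C]
    have h2 : 2 ≤ (minpoly R z).natDegree := by
      rw [minpoly.two_le_natDegree_iff hintegral]
      rintro ⟨r, hr⟩
      have h3 : (algebraMap R (AlgebraicClosure R)) ((r - p) ^ 2 + q ^ 2) = 0 := by
        simp only [map_add, map_pow, map_sub, hr, hzdef]
        linear_combination (algebraMap R (AlgebraicClosure R) q) ^ 2 * hI
      rw [map_eq_zero] at h3
      have := sq_nonneg (r - p)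
      have := pow_pos (abs_pos.2 hq) 2
      rw [sq_abs] at this
      linarith
    rw [eq_of_monic_of_dvd_of_natDegree_le (minpoly.monic hintegral) hmon h1 (by omega)]
    exact minpoly.dvd _ _ hz

theorem eval_mul_eval_pos {f : R[X]} {a b : R} (hab : a ≤ b)
    (h : ∀ x, a ≤ x → x ≤ b → f.eval x ≠ 0) : 0 < f.eval a * f.eval b := by
  induction hn : f.natDegree using Nat.strong_induction_on generalizing f with
  | h n ih =>
  rcases Nat.eq_zero_or_pos n with rfl | hpos
  · rw [eq_C_of_natDegree_eq_zero hn] at h ⊢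
    have := h a le_rfl hab
    simp only [Polynomial.eval_C] at this ⊢
    exact mul_self_pos.2 this
  have key : ∀ g k : R[X], f = g * k → 0 < g.natDegree → 0 < g.eval a * g.eval b →
      0 < f.eval a * f.eval b := by
    intro g k hgk hg0 hg
    have hf0 : f ≠ 0 := by rintro rfl; simp at hn; omega
    have hg1 : g ≠ 0 := by rintro rfl; simp at hg0
    have hk1 : k ≠ 0 := by rintro rfl; simp at hgk; exact hf0 hgk
    have h1 := ih k.natDegree (by rw [← hn, hgk, natDegree_mul hg1 hk1]; omega) (f := k)
      (fun x h1 h2 h3 => h x h1 h2 (by rw [hgk, Polynomial.eval_mul, h3, mul_zero])) rfl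
    rw [hgk, Polynomial.eval_mul, Polynomial.eval_mul]
    have := mul_pos hg h1
    linarith
  rcases exists_factor_of_isRealClosed (hn.symm ▸ hpos) with ⟨r, k, hk⟩ | ⟨p, q, hq, k, hk⟩
  · apply key _ k hk (by rw [natDegree_X_sub_C]; norm_num)
    simp only [Polynomial.eval_sub, Polynomial.eval_X, Polynomial.eval_C]
    rcases lt_or_ge r a with h1 | h1
    · exact mul_pos (by linarith) (by linarith)
    · rcases lt_or_ge b r with h2 | h2
      · exact mul_pos_of_neg_of_neg (by linarith) (by linarith)
      · exact absurd (by rw [hk]; simp) (h r h1 h2)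
  · have hq2 : 0 < q ^ 2 := by positivity
    apply key _ k hk (by rw [natDegree_add_C, natDegree_pow, natDegree_X_sub_C]; norm_num)
    simp only [Polynomial.eval_add, Polynomial.eval_pow, Polynomial.eval_sub, Polynomial.eval_X, Polynomial.eval_C]
    positivity
end

end

section

open Polynomial IntermediateField Module

section
variable {R : Type*} [Field R] [LinearOrder R] [IsStrictOrderedRing R]

theorem eq_zero_of_add_mul_I_eq_zero {I : AlgebraicClosure R} (hI : I ^ 2 = -1) {a b : R}
    (h : algebraMap R (AlgebraicClosure R) a + algebraMap R _ b * I = 0) : a = 0 ∧ b = 0 := by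
  have h1 : algebraMap R (AlgebraicClosure R) (a * a + b * b) = 0 := by
    simp only [map_add, map_mul]
    linear_combination (algebraMap R (AlgebraicClosure R) a - algebraMap R _ b * I) * h +
      (algebraMap R (AlgebraicClosure R) b) ^ 2 * hI
  rw [map_eq_zero, mul_self_add_mul_self_eq_zero] at h1
  exact h1

variable (R) in
/-- Real part, imaginary part and conjugation on the algebraic closure of a real closed field. -/
theorem exists_re_im_conj [IsRealClosed R] : ∃ (I : AlgebraicClosure R)
    (re im : AlgebraicClosure R →ₗ[R] R) (conj : AlgebraicClosure R →ₐ[R] AlgebraicClosure R),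
    I ^ 2 = -1 ∧ (∀ z, z = algebraMap R _ (re z) + algebraMap R _ (im z) * I) ∧
    (∀ z, conj z = algebraMap R _ (re z) - algebraMap R _ (im z) * I) ∧
    (∀ z, im (conj z) = - im z) ∧ (∀ z, conj (conj z) = z) := by
  obtain ⟨I, hI⟩ := exists_I R
  choose f g hfg using exists_add_mul_I hI
  have huniq : ∀ a b c d : R, algebraMap R (AlgebraicClosure R) a + algebraMap R _ b * I =
      algebraMap R _ c + algebraMap R _ d * I → a = c ∧ b = d := by
    intro a b c d h
    have := eq_zero_of_add_mul_I_eq_zero hI (a := a - c) (b := b - d) (by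
      simp only [map_sub]; linear_combination h)
    exact ⟨sub_eq_zero.1 this.1, sub_eq_zero.1 this.2⟩
  have hadd : ∀ x y, f (x + y) = f x + f y ∧ g (x + y) = g x + g y := fun x y => by
    apply huniq
    rw [← hfg (x + y)]
    conv_lhs => rw [hfg x, hfg y]
    simp only [map_add]; ring
  have hmul : ∀ x y, f (x * y) = f x * f y - g x * g y ∧ g (x * y) = f x * g y + g x * f y :=
    fun x y => by
    apply huniq
    rw [← hfg (x * y)]
    conv_lhs => rw [hfg x, hfg y]
    simp only [map_add, map_sub, map_mul]
    linear_combination (algebraMap R (AlgebraicClosure R) (g x) * algebraMap R _ (g y)) * hI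
  have halg : ∀ r : R, f (algebraMap R _ r) = r ∧ g (algebraMap R _ r) = 0 := fun r => by
    apply huniq
    rw [← hfg]; simp
  have hI' : f I = 0 ∧ g I = 1 := by
    apply huniq
    rw [← hfg]; simp
  let re : AlgebraicClosure R →ₗ[R] R :=
    { toFun := f
      map_add' := fun x y => (hadd x y).1
      map_smul' := fun r x => by rw [Algebra.smul_def, (hmul _ _).1, (halg r).1, (halg r).2]; simp }
  let im : AlgebraicClosure R →ₗ[R] R :=
    { toFun := g
      map_add' := fun x y => (hadd x y).2
      map_smul' := fun r x => by rw [Algebra.smul_def, (hmul _ _).2, (halg r).1, (halg r).2]; simp }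
  let conj : AlgebraicClosure R →ₐ[R] AlgebraicClosure R :=
    { toFun := fun z => algebraMap R _ (f z) - algebraMap R _ (g z) * I
      map_one' := by
        have := halg 1
        rw [map_one] at this
        simp [this.1, this.2]
      map_mul' := fun x y => by
        rw [(hmul x y).1, (hmul x y).2]
        simp only [map_add, map_sub, map_mul]
        linear_combination (-algebraMap R (AlgebraicClosure R) (g x) * algebraMap R _ (g y)) * hI
      map_zero' := by
        have := halg 0
        rw [map_zero] at this
        simp [this.1, this.2]
      map_add' := fun x y => by
        rw [(hadd x y).1, (hadd x y).2]
        simp only [map_add]; ring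
      commutes' := fun r => by simp [(halg r).1, (halg r).2] }
  have him : ∀ z, f (conj z) = f z ∧ g (conj z) = - g z := fun z => by
    apply huniq
    rw [← hfg]
    change algebraMap R _ (f z) - algebraMap R _ (g z) * I = _
    rw [map_neg]; ring
  refine ⟨I, re, im, conj, hI, hfg, fun z => rfl, fun z => (him z).2, fun z => ?_⟩
  change algebraMap R _ (f (conj z)) - algebraMap R _ (g (conj z)) * I = _
  rw [(him z).1, (him z).2, map_neg]
  conv_rhs => rw [hfg z]
  ring

variable {k L : Type*} [Field k] [Field L] [Algebra k L] [FiniteDimensional k L] [Algebra k R]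

omit [LinearOrder R] [IsStrictOrderedRing R] [FiniteDimensional k L] in
theorem exists_algHom_of_primitive {w : L} (hw : k⟮w⟯ = ⊤) (σ : L →ₐ[k] AlgebraicClosure R) {r : R}
    (h : σ w = algebraMap R _ r) : ∃ ψ : L →ₐ[k] R, ∀ x, σ x = algebraMap R _ (ψ x) := by
  let ι : R →ₐ[k] AlgebraicClosure R := IsScalarTower.toAlgHom k R _
  have h1 : ∀ x, σ x ∈ ι.fieldRange := by
    have : (⊤ : IntermediateField k L) ≤ ι.fieldRange.comap σ := by
      rw [← hw, adjoin_simple_le_iff]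
      exact ⟨r, h.symm⟩
    exact fun x => this (x := x) trivial
  let e := AlgEquiv.ofInjectiveField ι
  refine ⟨(e.symm : ι.range →ₐ[k] R).comp (σ.codRestrict ι.range h1), fun x => ?_⟩
  have := e.apply_symm_apply (σ.codRestrict ι.range h1 x)
  exact (congrArg Subtype.val this).symm

omit [LinearOrder R] [IsStrictOrderedRing R] in
theorem sum_embeddings_sq [CharZero k] {ι : Type*} [Fintype ι] [DecidableEq ι] (e : Basis ι k L)
    (he : ∀ i j, i ≠ j → Algebra.trace k L (e i * e j) = 0) (r : ι → R) :
    ∑ σ : L →ₐ[k] AlgebraicClosure R, (∑ i, algebraMap R _ (r i) * σ (e i)) ^ 2 =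
      algebraMap R _ (∑ i, r i ^ 2 * algebraMap k R (Algebra.trace k L (e i * e i))) := by
  have h1 : ∀ i j, ∑ σ : L →ₐ[k] AlgebraicClosure R, σ (e i) * σ (e j) =
      if i = j then algebraMap R _ (algebraMap k R (Algebra.trace k L (e i * e i))) else 0 := by
    intro i j
    have := trace_eq_sum_embeddings (K := k) (AlgebraicClosure R) (x := e i * e j)
    simp only [map_mul] at this
    rw [← this]
    split_ifs with h
    · subst h
      rw [← IsScalarTower.algebraMap_apply]
    · rw [he i j h, map_zero]
  simp_rw [sq, Finset.sum_mul_sum]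
  rw [Finset.sum_comm]
  simp_rw [Finset.sum_comm (s := (Finset.univ : Finset (L →ₐ[k] AlgebraicClosure R)))]
  rw [map_sum]
  refine Finset.sum_congr rfl fun i _ => ?_
  have h2 : ∀ j, ∑ σ : L →ₐ[k] AlgebraicClosure R, algebraMap R _ (r i) * σ (e i) *
      (algebraMap R _ (r j) * σ (e j)) = algebraMap R _ (r i) * algebraMap R _ (r j) *
      ∑ σ : L →ₐ[k] AlgebraicClosure R, σ (e i) * σ (e j) := by
    intro j
    rw [Finset.mul_sum]
    refine Finset.sum_congr rfl fun σ _ => by ring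
  simp_rw [h2, h1]
  simp
end

end

section

open Polynomial IntermediateField Module

section
theorem exists_ne_zero_of_card_lt {R ι T : Type*} [Field R] [Fintype ι] [Fintype T]
    (p : ι → Prop) [DecidablePred p] (F : (ι → R) →ₗ[R] (T → R))
    (h : Fintype.card T < (Finset.univ.filter p).card) :
    ∃ r : ι → R, r ≠ 0 ∧ F r = 0 ∧ ∀ i, ¬ p i → r i = 0 := by
  let G : (ι → R) →ₗ[R] ({i // ¬ p i} → R) := LinearMap.funLeft R R Subtype.val
  have h1 : LinearMap.ker (F.prod G) ≠ ⊥ := by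
    apply LinearMap.ker_ne_bot_of_finrank_lt
    have h2 : Fintype.card {i // ¬ p i} = (Finset.univ.filter fun i => ¬ p i).card :=
      Fintype.card_subtype _
    have h3 := Finset.card_filter_add_card_filter_not (s := (Finset.univ : Finset ι)) p
    rw [finrank_prod, finrank_fintype_fun_eq_card, finrank_fintype_fun_eq_card,
      finrank_fintype_fun_eq_card, h2, ← Finset.card_univ (α := ι)]
    omega
  obtain ⟨r, hr, hr0⟩ := (Submodule.ne_bot_iff _).1 h1
  replace hr := Prod.mk_eq_zero.1 (LinearMap.mem_ker.1 hr)
  exact ⟨r, hr0, hr.1, fun i hi => congrFun hr.2 ⟨i, hi⟩⟩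

variable {R : Type*} [Field R] [LinearOrder R] [IsStrictOrderedRing R] [IsRealClosed R]
variable {k L : Type*} [Field k] [Field L] [Algebra k L] [FiniteDimensional k L] [Algebra k R]

/-- The signature of the trace form detects embeddings into a real closed field. -/
theorem card_sign_trace_form [CharZero k] {ι : Type*} [Fintype ι] (e : Basis ι k L)
    (he : ∀ i j, i ≠ j → Algebra.trace k L (e i * e j) = 0) :
    (IsEmpty (L →ₐ[k] R) → 2 * (Finset.univ.filter fun i =>
      0 < algebraMap k R (Algebra.trace k L (e i * e i))).card ≤ Fintype.card ι) ∧
    (Nonempty (L →ₐ[k] R) → 2 * (Finset.univ.filter fun i =>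
      algebraMap k R (Algebra.trace k L (e i * e i)) < 0).card < Fintype.card ι) := by
  classical
  obtain ⟨I, re, im, conj, hI, hz, hconj, himconj, hcc⟩ := exists_re_im_conj R
  obtain ⟨w, hw⟩ := Field.exists_primitive_element k L
  have him0 : ∀ z, im z = 0 → z = algebraMap R _ (re z) := fun z h => by
    conv_lhs => rw [hz z, h]
    simp
  have hre0 : ∀ z, re z = 0 → z ^ 2 = algebraMap R _ (-(im z) ^ 2) := fun z h => by
    conv_lhs => rw [hz z, h]
    simp only [map_neg, map_pow, map_zero]
    linear_combination (algebraMap R (AlgebraicClosure R) (im z)) ^ 2 * hI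
  set E := L →ₐ[k] AlgebraicClosure R
  let c : E → E := fun σ => (conj.restrictScalars k).comp σ
  have hc : ∀ σ x, c σ x = conj (σ x) := fun σ x => rfl
  have hcinv : ∀ σ, c (c σ) = σ := fun σ => AlgHom.ext fun x => hcc _
  have hcard : Fintype.card E = Fintype.card ι := by
    rw [AlgHom.card, finrank_eq_card_basis e]
  have hS : (Finset.univ.filter fun σ : E => im (σ w) < 0).card =
      (Finset.univ.filter fun σ : E => 0 < im (σ w)).card := by
    refine Finset.card_bij' (fun σ _ => c σ) (fun σ _ => c σ) ?_ ?_ (fun σ _ => hcinv σ)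
      (fun σ _ => hcinv σ)
    · intro σ hσ
      simpa [hc, himconj] using hσ
    · intro σ hσ
      simpa [hc, himconj] using hσ
  have hsplit : Fintype.card ι = 2 * (Finset.univ.filter fun σ : E => 0 < im (σ w)).card +
      (Finset.univ.filter fun σ : E => im (σ w) = 0).card := by
    rw [← hcard, ← Finset.card_univ,
      ← Finset.card_filter_add_card_filter_not (s := Finset.univ) (fun σ : E => im (σ w) = 0)]
    have : (Finset.univ.filter fun σ : E => ¬ im (σ w) = 0) =
      (Finset.univ.filter fun σ : E => im (σ w) < 0) ∪
        (Finset.univ.filter fun σ : E => 0 < im (σ w)) := by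
      ext σ
      simp
    rw [this, Finset.card_union_of_disjoint, hS]
    · ring
    · rw [Finset.disjoint_filter]
      intro σ _ h1 h2
      exact lt_asymm h1 h2
  have hT : Fintype.card {σ : E // 0 < im (σ w)} =
      (Finset.univ.filter fun σ : E => 0 < im (σ w)).card := Fintype.card_subtype _
  let y : E → (ι → R) →ₗ[R] AlgebraicClosure R := fun σ =>
    { toFun := fun r => ∑ i, algebraMap R _ (r i) * σ (e i)
      map_add' := fun r s => by simp [add_mul, Finset.sum_add_distrib]
      map_smul' := fun a r => by
        simp [Finset.mul_sum, Algebra.smul_def, mul_assoc] }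
  have hy : ∀ σ r, y (c σ) r = conj (y σ r) := by
    intro σ r
    change ∑ i, _ = conj (∑ i, _)
    rw [map_sum]
    refine Finset.sum_congr rfl fun i _ => ?_
    rw [map_mul, AlgHom.commutes]
    rfl
  have hsum : ∀ r, ∑ σ, (y σ r) ^ 2 = algebraMap R _
    (∑ i, r i ^ 2 * algebraMap k R (Algebra.trace k L (e i * e i))) := sum_embeddings_sq e he
  have hinj := (algebraMap R (AlgebraicClosure R)).injective
  constructor
  · intro hempty
    have h0 : ∀ σ : E, im (σ w) ≠ 0 := fun σ h =>
      hempty.false (exists_algHom_of_primitive hw σ (him0 _ h)).choose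
    have hS0 : (Finset.univ.filter fun σ : E => im (σ w) = 0).card = 0 := by
      rw [Finset.card_eq_zero, Finset.filter_eq_empty_iff]
      exact fun σ _ => h0 σ
    by_contra hlt
    obtain ⟨r, hr0, hr, hrp⟩ := exists_ne_zero_of_card_lt (R := R) _
      (LinearMap.pi fun σ : {σ : E // 0 < im (σ w)} => re.comp (y σ.1))
      (show _ < (Finset.univ.filter fun i =>
        0 < algebraMap k R (Algebra.trace k L (e i * e i))).card by omega)
    have hpos : ∀ σ : E, 0 < im (σ w) → y σ r ^ 2 = algebraMap R _ (-(im (y σ r)) ^ 2) :=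
      fun σ hσ => hre0 _ (congrFun hr ⟨σ, hσ⟩)
    have hall : ∀ σ : E, ∃ v : R, y σ r ^ 2 = algebraMap R _ (-v ^ 2) := by
      intro σ
      rcases (h0 σ).lt_or_gt with h | h
      · have h2 := hpos (c σ) (by rw [hc, himconj]; linarith)
        refine ⟨im (y (c σ) r), ?_⟩
        have h3 := congrArg conj h2
        rw [AlgHom.commutes, map_pow, hy, hcc] at h3
        rw [h3, hy]
      · exact ⟨_, hpos σ h⟩
    choose v hv using hall
    have h1 := hsum r
    simp_rw [hv, ← map_sum] at h1
    have h2 := hinj h1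
    have h3 : ∑ σ : E, (-v σ ^ 2) ≤ 0 := Finset.sum_nonpos fun σ _ => by nlinarith [sq_nonneg (v σ)]
    have h4 : 0 < ∑ i, r i ^ 2 * algebraMap k R (Algebra.trace k L (e i * e i)) := by
      obtain ⟨j, hj⟩ := Function.ne_iff.1 hr0
      have hge : ∀ i, r i ≠ 0 → 0 < algebraMap k R (Algebra.trace k L (e i * e i)) := fun i hi => by
        by_contra hn
        exact hi (hrp i hn)
      refine Finset.sum_pos' (fun i _ => ?_) ⟨j, Finset.mem_univ _,
        mul_pos (by have : r j ≠ 0 := hj; positivity) (hge j hj)⟩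
      by_cases hi : r i = 0
      · simp [hi]
      · exact mul_nonneg (sq_nonneg _) (hge i hi).le
    linarith
  · rintro ⟨ψ⟩
    have hS0 : 0 < (Finset.univ.filter fun σ : E => im (σ w) = 0).card := by
      rw [Finset.card_pos]
      refine ⟨(IsScalarTower.toAlgHom k R _).comp ψ, ?_⟩
      simp only [Finset.mem_filter, Finset.mem_univ, true_and]
      change im (algebraMap R _ (ψ w)) = 0
      set q := algebraMap R (AlgebraicClosure R) (ψ w) with hq
      have h3 : im (conj q) = im q := by rw [hq, AlgHom.commutes]
      rw [himconj] at h3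
      linarith
    by_contra hlt
    obtain ⟨r, hr0, hr, hrp⟩ := exists_ne_zero_of_card_lt (R := R) _
      (LinearMap.pi fun σ : {σ : E // 0 < im (σ w)} => im.comp (y σ.1))
      (show _ < (Finset.univ.filter fun i =>
        algebraMap k R (Algebra.trace k L (e i * e i)) < 0).card by omega)
    have hpos : ∀ σ : E, 0 < im (σ w) → y σ r = algebraMap R _ (re (y σ r)) :=
      fun σ hσ => him0 _ (congrFun hr ⟨σ, hσ⟩)
    have hall : ∀ σ : E, ∃ v : R, y σ r = algebraMap R _ v := by
      intro σ
      rcases lt_trichotomy (im (σ w)) 0 with h | h | h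
      · have h2 := hpos (c σ) (by rw [hc, himconj]; linarith)
        refine ⟨re (y (c σ) r), ?_⟩
        have h3 := congrArg conj h2
        rw [AlgHom.commutes, hy, hcc] at h3
        rw [h3, hy]
      · obtain ⟨ψ', hψ'⟩ := exists_algHom_of_primitive hw σ (him0 _ h)
        refine ⟨∑ i, r i * ψ' (e i), ?_⟩
        rw [map_sum]
        refine Finset.sum_congr rfl fun i _ => ?_
        rw [hψ', map_mul]
      · exact ⟨_, hpos σ h⟩
    choose v hv using hall
    have h1 := hsum r
    simp_rw [hv, ← map_pow, ← map_sum] at h1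
    have h2 := hinj h1
    have h3 : 0 ≤ ∑ σ : E, v σ ^ 2 := Finset.sum_nonneg fun σ _ => sq_nonneg (v σ)
    have h4 : ∑ i, r i ^ 2 * algebraMap k R (Algebra.trace k L (e i * e i)) < 0 := by
      obtain ⟨j, hj⟩ := Function.ne_iff.1 hr0
      have hge : ∀ i, r i ≠ 0 → algebraMap k R (Algebra.trace k L (e i * e i)) < 0 := fun i hi => by
        by_contra hn
        exact hi (hrp i hn)
      refine Finset.sum_neg' (fun i _ => ?_) ⟨j, Finset.mem_univ _,
        mul_neg_of_pos_of_neg (by have : r j ≠ 0 := hj; positivity) (hge j hj)⟩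
      by_cases hi : r i = 0
      · simp [hi]
      · exact mul_nonpos_of_nonneg_of_nonpos (sq_nonneg _) (hge i hi).le
    linarith

/-- Finite extensions embed into one real closed field as soon as they embed into another one
inducing the same order on the base field. -/
theorem nonempty_algHom_of_isRealClosed {R₂ : Type*} [Field R₂] [LinearOrder R₂]
    [IsStrictOrderedRing R₂] [IsRealClosed R₂] [Algebra k R₂]
    (hk : ∀ c : k, 0 < algebraMap k R c → 0 < algebraMap k R₂ c)
    (h : Nonempty (L →ₐ[k] R)) : Nonempty (L →ₐ[k] R₂) := by
  have : CharZero k := (algebraMap k R).charZero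
  have : Invertible (2 : k) := invertibleOfNonzero two_ne_zero
  obtain ⟨e, he⟩ := LinearMap.BilinForm.exists_orthogonal_basis
    (B := Algebra.traceForm k L) ⟨fun x y => by simp [Algebra.traceForm_apply, mul_comm]⟩
  have he' : ∀ i j, i ≠ j → Algebra.trace k L (e i * e j) = 0 := fun i j hij => he hij
  have hne : ∀ i, Algebra.trace k L (e i * e i) ≠ 0 := fun i =>
    he.not_isOrtho_basis_self_of_separatingLeft (traceForm_nondegenerate k L).1 i
  by_contra hcon
  rw [not_nonempty_iff] at hcon
  have h1 := (card_sign_trace_form (R := R) e he').2 h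
  have h2 := (card_sign_trace_form (R := R₂) e he').1 hcon
  have h3 := Finset.card_filter_add_card_filter_not (s := Finset.univ) fun i =>
      algebraMap k R (Algebra.trace k L (e i * e i)) < 0
  have h4 : (Finset.univ.filter fun i => ¬ algebraMap k R (Algebra.trace k L (e i * e i)) < 0).card
      ≤ (Finset.univ.filter fun i => 0 < algebraMap k R₂ (Algebra.trace k L (e i * e i))).card := by
    apply Finset.card_le_card
    intro i hi
    simp only [Finset.mem_filter, Finset.mem_univ, true_and, not_lt] at hi ⊢
    exact hk _ (lt_of_le_of_ne hi ((_root_.map_ne_zero _).2 (hne i)).symm)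
  rw [Finset.card_univ] at h3
  omega
end

end

section

open Polynomial IntermediateField Module

section
variable {R : Type*} [Field R] [LinearOrder R] [IsStrictOrderedRing R]
variable {k : Type*} [Field k] [Algebra k R]

theorem exists_isIntegral_same_side (Z : Finset R) (hZ : ∀ z ∈ Z, IsIntegral k z) (t : R) :
    ∃ u : R, IsIntegral k u ∧ ∀ z ∈ Z, (z < t → z < u) ∧ (t < z → u < z) := by
  have hhalf : IsIntegral k (1 / 2 : R) := by
    have : (1 / 2 : R) = algebraMap k R (1 / 2) := by
      rw [map_div₀, map_one, map_ofNat]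
    rw [this]
    exact isIntegral_algebraMap
  by_cases h1 : (Z.filter (· < t)).Nonempty <;> by_cases h2 : (Z.filter (t < ·)).Nonempty
  · obtain ⟨hm1, hm2⟩ := Finset.mem_filter.1 (Finset.max'_mem _ h1)
    obtain ⟨hn1, hn2⟩ := Finset.mem_filter.1 (Finset.min'_mem _ h2)
    refine ⟨((Z.filter (· < t)).max' h1 + (Z.filter (t < ·)).min' h2) * (1 / 2),
      ((hZ _ hm1).add (hZ _ hn1)).mul hhalf, fun z hz => ⟨fun h => ?_, fun h => ?_⟩⟩
    · have := Finset.le_max' (Z.filter (· < t)) z (Finset.mem_filter.2 ⟨hz, h⟩)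
      linarith
    · have := Finset.min'_le (Z.filter (t < ·)) z (Finset.mem_filter.2 ⟨hz, h⟩)
      linarith
  · obtain ⟨hm1, hm2⟩ := Finset.mem_filter.1 (Finset.max'_mem _ h1)
    refine ⟨(Z.filter (· < t)).max' h1 + 1, (hZ _ hm1).add isIntegral_one,
      fun z hz => ⟨fun h => ?_, fun h => ?_⟩⟩
    · have := Finset.le_max' (Z.filter (· < t)) z (Finset.mem_filter.2 ⟨hz, h⟩)
      linarith
    · exact absurd ⟨z, Finset.mem_filter.2 ⟨hz, h⟩⟩ h2
  · obtain ⟨hn1, hn2⟩ := Finset.mem_filter.1 (Finset.min'_mem _ h2)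
    refine ⟨(Z.filter (t < ·)).min' h2 - 1, (hZ _ hn1).sub isIntegral_one,
      fun z hz => ⟨fun h => ?_, fun h => ?_⟩⟩
    · exact absurd ⟨z, Finset.mem_filter.2 ⟨hz, h⟩⟩ h1
    · have := Finset.min'_le (Z.filter (t < ·)) z (Finset.mem_filter.2 ⟨hz, h⟩)
      linarith
  · refine ⟨0, isIntegral_zero, fun z hz => ⟨fun h => ?_, fun h => ?_⟩⟩
    · exact absurd ⟨z, Finset.mem_filter.2 ⟨hz, h⟩⟩ h1
    · exact absurd ⟨z, Finset.mem_filter.2 ⟨hz, h⟩⟩ h2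

variable [IsRealClosed R]

theorem exists_isIntegral_same_sign (F : Finset k[X]) (t : R) :
    ∃ u : R, IsIntegral k u ∧
      ∀ f ∈ F, (0 < aeval t f → 0 < aeval u f) ∧ (aeval t f = 0 → aeval u f = 0) := by
  classical
  by_cases ht : IsIntegral k t
  · exact ⟨t, ht, fun f _ => ⟨id, id⟩⟩
  have hzero : ∀ f : k[X], aeval t f = 0 → f = 0 := by
    intro f hf
    by_contra h0
    exact ht (IsAlgebraic.isIntegral ⟨f, h0, hf⟩)
  let Z : Finset R := F.biUnion fun f => (f.aroots R).toFinset
  have hZ : ∀ z ∈ Z, IsIntegral k z := by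
    intro z hz
    obtain ⟨f, hf, hz⟩ := Finset.mem_biUnion.1 hz
    rw [Multiset.mem_toFinset, mem_aroots] at hz
    exact IsAlgebraic.isIntegral ⟨f, hz.1, hz.2⟩
  obtain ⟨u, hu, hside⟩ := exists_isIntegral_same_side Z hZ t
  refine ⟨u, hu, fun f hf => ⟨fun hpos => ?_, fun h => by rw [hzero f h, map_zero]⟩⟩
  have hf0 : f ≠ 0 := by rintro rfl; simp at hpos
  have hmem : ∀ x, (f.map (algebraMap k R)).eval x = 0 → x ∈ Z := by
    intro x hx
    refine Finset.mem_biUnion.2 ⟨f, hf, ?_⟩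
    rw [Multiset.mem_toFinset, mem_aroots, Polynomial.aeval_def, ← Polynomial.eval_map]
    exact ⟨hf0, hx⟩
  rw [Polynomial.aeval_def, ← Polynomial.eval_map] at hpos ⊢
  rcases le_total t u with h | h
  · have := eval_mul_eval_pos (f := f.map (algebraMap k R)) h (fun x h1 h2 hx => by
      rcases h1.lt_or_eq with h1 | rfl
      · exact absurd ((hside x (hmem x hx)).2 h1) (not_lt.2 h2)
      · exact hpos.ne' hx)
    exact pos_of_mul_pos_right this hpos.le
  · have := eval_mul_eval_pos (f := f.map (algebraMap k R)) h (fun x h1 h2 hx => by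
      rcases h2.lt_or_eq with h2 | rfl
      · exact absurd ((hside x (hmem x hx)).1 h2) (not_lt.2 h1)
      · exact hpos.ne' hx)
    exact pos_of_mul_pos_left this hpos.le

/-- Solutions of finitely many univariate sign conditions transfer between real closed fields. -/
theorem exists_sign_transfer {R₂ : Type*} [Field R₂] [LinearOrder R₂]
    [IsStrictOrderedRing R₂] [IsRealClosed R₂] [Algebra k R₂]
    (hk : ∀ c : k, 0 < algebraMap k R c → 0 < algebraMap k R₂ c) (F : Finset k[X]) (t : R) :
    ∃ τ : R₂, ∀ f ∈ F, (0 < aeval t f → 0 < aeval τ f) ∧ (aeval t f = 0 → aeval τ f = 0) := by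
  classical
  obtain ⟨u, hu, hsign⟩ := exists_isIntegral_same_sign F t
  have hsq : ∀ f : k[X], ∃ s : R, 0 < aeval u f → s * s = aeval u f := fun f => by
    by_cases h : 0 < aeval u f
    · obtain ⟨s, hs⟩ := IsRealClosed.nonneg_iff_isSquare.1 h.le
      exact ⟨s, fun _ => hs.symm⟩
    · exact ⟨0, fun h' => absurd h' h⟩
  choose s hs using hsq
  let G : Finset k[X] := F.filter fun f => 0 < aeval u f
  let S : Set R := insert u (s '' G)
  have hS : S.Finite := (G.finite_toSet.image s).insert u
  let L := adjoin k S
  have hintegral : ∀ x ∈ S, IsIntegral k x := by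
    rintro x (rfl | ⟨f, hf, rfl⟩)
    · exact hu
    · have h1 : s f ^ 2 = aeval u f := by rw [sq]; exact hs f (Finset.mem_filter.1 hf).2
      refine IsIntegral.of_pow (n := 2) (by norm_num) ?_
      rw [h1]
      exact IsIntegral.of_mem_of_fg _ (hu.fg_adjoin_singleton) _
        (aeval_mem_adjoin_singleton k u)
  have : Finite S := hS
  have : FiniteDimensional k L := finiteDimensional_adjoin hintegral
  obtain ⟨ψ⟩ := nonempty_algHom_of_isRealClosed (R := R) (R₂ := R₂) (L := L) hk ⟨L.val⟩
  have huL : u ∈ L := subset_adjoin _ _ (Set.mem_insert _ _)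
  have hev : ∀ f : k[X], aeval (ψ ⟨u, huL⟩) f = ψ (aeval (⟨u, huL⟩ : L) f) := fun f =>
    aeval_algHom_apply ψ _ f
  have hev' : ∀ f : k[X], ((aeval (⟨u, huL⟩ : L) f : L) : R) = aeval u f := fun f =>
    (aeval_algHom_apply L.val (⟨u, huL⟩ : L) f).symm
  refine ⟨ψ ⟨u, huL⟩, fun f hf => ⟨fun h => ?_, fun h => ?_⟩⟩
  · have h1 := (hsign f hf).1 h
    have hsL : s f ∈ L := subset_adjoin _ _ (Set.mem_insert_of_mem _
      ⟨f, Finset.mem_coe.2 (Finset.mem_filter.2 ⟨hf, h1⟩), rfl⟩)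
    have h2 : aeval (⟨u, huL⟩ : L) f = ⟨s f, hsL⟩ * ⟨s f, hsL⟩ :=
      Subtype.ext (by rw [hev']; exact (hs f h1).symm)
    have h3 : (⟨s f, hsL⟩ : L) ≠ 0 := by
      intro h0
      have : s f = 0 := congrArg Subtype.val h0
      have h4 := hs f h1
      rw [this] at h4
      simp at h4
      exact h1.ne h4
    rw [hev, h2, map_mul]
    exact mul_self_pos.2 ((_root_.map_ne_zero ψ).2 h3)
  · have h1 := (hsign f hf).2 h
    have h2 : aeval (⟨u, huL⟩ : L) f = 0 := Subtype.ext (by rw [hev', h1]; rfl)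
    rw [hev, h2, map_zero]
end

end

section

open Polynomial Filter

section

theorem exists_isRoot_of_odd_natDegree_real {f : ℝ[X]} (hf : Odd f.natDegree) :
    ∃ x, f.IsRoot x := by
  have key : ∀ g : ℝ[X], Odd g.natDegree → 0 ≤ g.leadingCoeff → ∃ x, g.IsRoot x := by
    intro g hg hl
    have hdeg : 0 < g.degree := natDegree_pos_iff_degree_pos.1 hg.pos
    have h1 := g.tendsto_atTop_of_leadingCoeff_nonneg hdeg hl
    have hnd : (g.comp (-Polynomial.X)).natDegree = g.natDegree := by
      rw [natDegree_comp, natDegree_neg, natDegree_X, mul_one]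
    have h2 := (g.comp (-Polynomial.X)).tendsto_atBot_of_leadingCoeff_nonpos
      (natDegree_pos_iff_degree_pos.1 (by rw [hnd]; exact hg.pos))
      (by rw [leadingCoeff_comp (by rw [natDegree_neg, natDegree_X]; exact one_ne_zero)]
          simp [hg.neg_one_pow, hl])
    obtain ⟨a, ha⟩ := (h1.eventually_ge_atTop 0).exists
    obtain ⟨b, hb⟩ := (h2.eventually_le_atBot 0).exists
    rw [eval_comp] at hb
    exact mem_range_of_exists_le_of_exists_ge g.continuous ⟨_, hb⟩ ⟨_, ha⟩
  rcases le_total 0 f.leadingCoeff with h | h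
  · exact key f hf h
  · obtain ⟨x, hx⟩ := key (-f) (by rwa [natDegree_neg]) (by rw [leadingCoeff_neg]; linarith)
    exact ⟨x, by simpa [IsRoot] using hx⟩

theorem Filter.Germ.isRealClosed_real {α : Type*} (φ : Ultrafilter α) :
    IsRealClosed (Germ (φ : Filter α) ℝ) := by
  refine IsRealClosed.of_linearOrderedField (fun {x} hx => ?_) (fun {f} hf => ?_)
  · induction x using Germ.inductionOn with
    | _ g =>
      refine ⟨((fun a => Real.sqrt (g a) : α → ℝ) : Germ (φ : Filter α) ℝ), ?_⟩
      rw [← Germ.coe_mul]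
      refine Germ.coe_eq.2 ?_
      have : ∀ᶠ a in (φ : Filter α), 0 ≤ g a := Germ.coe_le.1 hx
      filter_upwards [this] with a ha
      exact (Real.mul_self_sqrt ha).symm
  · have hc : ∀ i, ∃ c : α → ℝ, ((c : α → ℝ) : Germ (φ : Filter α) ℝ) = f.coeff i := fun i =>
      Quotient.exists_rep _
    choose c hc using hc
    set n := f.natDegree
    have hroot : ∀ a, ∃ r : ℝ, c n a ≠ 0 → ∑ i ∈ Finset.range (n + 1), c i a * r ^ i = 0 := by
      intro a
      by_cases h : c n a = 0
      · exact ⟨0, fun h' => absurd h h'⟩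
      let p : ℝ[X] := ∑ i ∈ Finset.range (n + 1), Polynomial.C (c i a) * Polynomial.X ^ i
      have hcoeff : p.coeff n = c n a := by
        simp [p, finsetSum_coeff, Polynomial.coeff_C_mul, Polynomial.coeff_X_pow]
      have hdeg : p.natDegree = n := by
        refine le_antisymm (natDegree_sum_le_of_forall_le _ _ fun i hi => ?_)
          (le_natDegree_of_ne_zero (by rwa [hcoeff]))
        exact (natDegree_C_mul_X_pow_le _ _).trans (Nat.lt_succ_iff.1 (Finset.mem_range.1 hi))
      obtain ⟨r, hr⟩ := exists_isRoot_of_odd_natDegree_real (f := p) (by rwa [hdeg])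
      refine ⟨r, fun _ => ?_⟩
      simpa [p, IsRoot, eval_finsetSum] using hr
    choose r hr using hroot
    refine ⟨(r : Germ (φ : Filter α) ℝ), ?_⟩
    rw [IsRoot, eval_eq_sum_range]
    have hne : ∀ᶠ a in (φ : Filter α), c n a ≠ 0 := by
      rw [Ultrafilter.eventually_not]
      intro h
      have h1 : ((c n : α → ℝ) : Germ (φ : Filter α) ℝ) = 0 := Germ.coe_eq.2 h
      rw [hc] at h1
      have : f = 0 := leadingCoeff_eq_zero.1 h1
      rw [show n = 0 by simp [n, this]] at hf
      simp at hf
    have hsum : ∑ i ∈ Finset.range (n + 1), f.coeff i * (r : Germ (φ : Filter α) ℝ) ^ i =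
        Germ.coeRingHom (φ : Filter α) (∑ i ∈ Finset.range (n + 1), c i * r ^ i) := by
      rw [map_sum]
      refine Finset.sum_congr rfl fun i _ => ?_
      rw [map_mul, map_pow, ← hc]
      rfl
    rw [hsum]
    refine Germ.coe_eq.2 ?_
    filter_upwards [hne] with a ha
    simpa using hr a ha
end

end

section

open Filter

section

variable {R : Type*} [Field R] [LinearOrder R] [IsStrictOrderedRing R] [Algebra ℝ R]

theorem algebraMap_real_pos_iff {c : ℝ} : 0 < algebraMap ℝ R c ↔ 0 < c := by
  have key : ∀ c : ℝ, 0 ≤ c → 0 ≤ algebraMap ℝ R c := fun c hc => by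
    rw [← Real.mul_self_sqrt hc, map_mul]
    exact mul_self_nonneg _
  constructor
  · intro h
    by_contra h'
    have := key (-c) (by linarith)
    rw [map_neg] at this
    linarith
  · intro h
    exact lt_of_le_of_ne (key c h.le) (Ne.symm ((_root_.map_ne_zero _).2 h.ne'))

/-- Evaluation of polynomials along an ultrafilter. -/
noncomputable def evalGerm {σ : Type*} (φ : Ultrafilter (σ → ℝ)) :
    MvPolynomial σ ℝ →+* Germ (φ : Filter (σ → ℝ)) ℝ :=
  (Germ.coeRingHom (φ : Filter (σ → ℝ))).comp
    (RingHom.pi fun b : σ → ℝ => MvPolynomial.eval b)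

theorem evalGerm_apply {σ : Type*} (φ : Ultrafilter (σ → ℝ)) (f : MvPolynomial σ ℝ) :
    evalGerm φ f = ((fun b => MvPolynomial.eval b f : (σ → ℝ) → ℝ) : Germ (φ : Filter (σ → ℝ)) ℝ) :=
  rfl

theorem evalGerm_finSucc {n : ℕ} (φ : Ultrafilter (Fin n → ℝ)) (β : (Fin n → ℝ) → ℝ)
    (f : MvPolynomial (Fin (n + 1)) ℝ) :
    (MvPolynomial.finSuccEquiv ℝ n f).eval₂ (evalGerm φ) (β : Germ (φ : Filter (Fin n → ℝ)) ℝ) =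
      ((fun b => MvPolynomial.eval (Fin.cons (β b) b : Fin (n + 1) → ℝ) f :
        (Fin n → ℝ) → ℝ) : Germ (φ : Filter (Fin n → ℝ)) ℝ) := by
  induction f using MvPolynomial.induction_on with
  | C a =>
    rw [MvPolynomial.finSuccEquiv_apply, MvPolynomial.eval₂Hom_C]
    simp only [RingHom.comp_apply, Polynomial.eval₂_C, evalGerm_apply, MvPolynomial.eval_C]
  | add p q hp hq =>
    rw [map_add, Polynomial.eval₂_add, hp, hq]
    simp only [map_add]
    rfl
  | mul_X p i hp =>
    rw [map_mul, Polynomial.eval₂_mul, hp]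
    simp only [map_mul, MvPolynomial.eval_X]
    refine Eq.trans ?_ (Germ.coe_mul _ _).symm
    congr 1
    induction i using Fin.cases with
    | zero => rw [MvPolynomial.finSuccEquiv_X_zero, Polynomial.eval₂_X]; rfl
    | succ i =>
      rw [MvPolynomial.finSuccEquiv_X_succ, Polynomial.eval₂_C, evalGerm_apply]
      simp

omit [LinearOrder R] [IsStrictOrderedRing R] in
theorem aeval_finSucc {n : ℕ} (x : Fin (n + 1) → R) (f : MvPolynomial (Fin (n + 1)) ℝ) :
    (MvPolynomial.finSuccEquiv ℝ n f).eval₂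
      (MvPolynomial.aeval (Fin.tail x) : MvPolynomial (Fin n) ℝ →ₐ[ℝ] R).toRingHom (x 0) =
      MvPolynomial.aeval x f := by
  induction f using MvPolynomial.induction_on with
  | C a =>
    rw [MvPolynomial.finSuccEquiv_apply, MvPolynomial.eval₂Hom_C]
    simp
  | add p q hp hq => rw [map_add, Polynomial.eval₂_add, hp, hq, map_add]
  | mul_X p i hp =>
    rw [map_mul, Polynomial.eval₂_mul, hp, map_mul, MvPolynomial.aeval_X]
    congr 1
    induction i using Fin.cases with
    | zero => rw [MvPolynomial.finSuccEquiv_X_zero, Polynomial.eval₂_X]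
    | succ i =>
      rw [MvPolynomial.finSuccEquiv_X_succ, Polynomial.eval₂_C]
      simp [Fin.tail]

variable [IsRealClosed R]

theorem exists_lift_of_finset {n : ℕ} (x : Fin (n + 1) → R) (φ : Ultrafilter (Fin n → ℝ))
    (hφ : ∀ f : MvPolynomial (Fin n) ℝ,
      (0 < MvPolynomial.aeval (Fin.tail x) f → ∀ᶠ b in φ, 0 < MvPolynomial.eval b f) ∧
      (MvPolynomial.aeval (Fin.tail x) f = 0 → ∀ᶠ b in φ, MvPolynomial.eval b f = 0))
    (F : Finset (MvPolynomial (Fin (n + 1)) ℝ)) :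
    ∃ b : Fin (n + 1) → ℝ, ∀ f ∈ F,
      (0 < MvPolynomial.aeval x f → 0 < MvPolynomial.eval b f) ∧
      (MvPolynomial.aeval x f = 0 → MvPolynomial.eval b f = 0) := by
  classical
  have hRCF := Filter.Germ.isRealClosed_real φ
  let e : MvPolynomial (Fin n) ℝ →+* R :=
    (MvPolynomial.aeval (Fin.tail x) : MvPolynomial (Fin n) ℝ →ₐ[ℝ] R).toRingHom
  let D := MvPolynomial (Fin n) ℝ ⧸ RingHom.ker e
  have : (RingHom.ker e).IsPrime := RingHom.ker_isPrime e
  let e₁ : D →+* R := RingHom.kerLift e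
  have he₁ : Function.Injective e₁ := RingHom.kerLift_injective e
  let e₂ : D →+* Germ (φ : Filter (Fin n → ℝ)) ℝ := Ideal.Quotient.lift _ (evalGerm φ)
    fun a ha => Germ.coe_eq.2 ((hφ a).2 (RingHom.mem_ker.1 ha))
  have hpos : ∀ a : D, 0 < e₁ a → 0 < e₂ a := by
    intro a ha
    obtain ⟨a, rfl⟩ := Ideal.Quotient.mk_surjective a
    exact Germ.coe_pos.2 ((hφ a).1 ha)
  have he₂ : Function.Injective e₂ := by
    rw [injective_iff_map_eq_zero]
    intro a ha
    by_contra h0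
    have h1 : e₁ a ≠ 0 := fun h => h0 (he₁ (h.trans (map_zero _).symm))
    rcases lt_or_gt_of_ne h1 with h | h
    · have := hpos (-a) (by rw [map_neg]; linarith)
      rw [map_neg, ha, neg_zero] at this
      exact lt_irrefl _ this
    · have := hpos a h
      rw [ha] at this
      exact lt_irrefl _ this
  let k := FractionRing D
  let l₁ : k →+* R := IsFractionRing.lift he₁
  let l₂ : k →+* Germ (φ : Filter (Fin n → ℝ)) ℝ := IsFractionRing.lift he₂
  let _ : Algebra k R := l₁.toAlgebra
  let _ : Algebra k (Germ (φ : Filter (Fin n → ℝ)) ℝ) := l₂.toAlgebra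
  have hl₁ : ∀ a, l₁ (algebraMap D k a) = e₁ a := IsFractionRing.lift_algebraMap he₁
  have hl₂ : ∀ a, l₂ (algebraMap D k a) = e₂ a := IsFractionRing.lift_algebraMap he₂
  have hk : ∀ c : k, 0 < algebraMap k R c →
      0 < algebraMap k (Germ (φ : Filter (Fin n → ℝ)) ℝ) c := by
    intro c hc
    change 0 < l₂ c
    replace hc : 0 < l₁ c := hc
    obtain ⟨a, b, hb, rfl⟩ := IsFractionRing.div_surjective (A := D) c
    have hb0 : algebraMap D k b ≠ 0 :=
      IsFractionRing.to_map_ne_zero_of_mem_nonZeroDivisors hb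
    have hab : algebraMap D k a / algebraMap D k b =
        algebraMap D k (a * b) * ((algebraMap D k b)⁻¹ * (algebraMap D k b)⁻¹) := by
      rw [div_eq_mul_inv, map_mul, mul_assoc, mul_inv_cancel_left₀ hb0]
    rw [hab, map_mul l₁, map_mul l₁, hl₁] at hc
    rw [hab, map_mul l₂, map_mul l₂, hl₂]
    have h1 : 0 < l₁ (algebraMap D k b)⁻¹ * l₁ (algebraMap D k b)⁻¹ :=
      mul_self_pos.2 ((_root_.map_ne_zero l₁).2 (inv_ne_zero hb0))
    have h2 : 0 < l₂ (algebraMap D k b)⁻¹ * l₂ (algebraMap D k b)⁻¹ :=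
      mul_self_pos.2 ((_root_.map_ne_zero l₂).2 (inv_ne_zero hb0))
    exact mul_pos (hpos _ (pos_of_mul_pos_left hc h1.le)) h2
  let toK : MvPolynomial (Fin (n + 1)) ℝ → Polynomial k := fun f =>
    (MvPolynomial.finSuccEquiv ℝ n f).map ((algebraMap D k).comp (Ideal.Quotient.mk _))
  obtain ⟨τ, hτ⟩ := exists_sign_transfer hk (F.image toK) (x 0)
  have h₁ : ∀ f, Polynomial.aeval (x 0) (toK f) = MvPolynomial.aeval x f := by
    intro f
    rw [← aeval_finSucc, Polynomial.aeval_def, Polynomial.eval₂_map]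
    congr 1
    ext a
    · exact hl₁ _
    · exact hl₁ _
  obtain ⟨β, rfl⟩ := Quotient.exists_rep τ
  have h₂ : ∀ f, Polynomial.aeval (β : Germ (φ : Filter (Fin n → ℝ)) ℝ) (toK f) = 
      ((fun b => MvPolynomial.eval (Fin.cons (β b) b : Fin (n + 1) → ℝ) f :
        (Fin n → ℝ) → ℝ) : Germ (φ : Filter (Fin n → ℝ)) ℝ) := by
    intro f
    rw [← evalGerm_finSucc, Polynomial.aeval_def, Polynomial.eval₂_map]
    congr 1
    refine RingHom.ext fun a => ?_
    exact hl₂ _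
  have hev : ∀ f ∈ F, ∀ᶠ b in (φ : Filter (Fin n → ℝ)),
      (0 < MvPolynomial.aeval x f →
        0 < MvPolynomial.eval (Fin.cons (β b) b : Fin (n + 1) → ℝ) f) ∧
      (MvPolynomial.aeval x f = 0 →
        MvPolynomial.eval (Fin.cons (β b) b : Fin (n + 1) → ℝ) f = 0) := by
    intro f hf
    obtain ⟨hp, hz⟩ := hτ _ (Finset.mem_image_of_mem toK hf)
    rw [h₁] at hp hz
    refine Filter.Eventually.and ?_ ?_
    · by_cases h : 0 < MvPolynomial.aeval x f
      · have := (h₂ f) ▸ hp h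
        filter_upwards [Germ.coe_pos.1 this] with b hb _ using hb
      · exact Filter.Eventually.of_forall fun b h' => absurd h' h
    · by_cases h : MvPolynomial.aeval x f = 0
      · have := (h₂ f) ▸ hz h
        filter_upwards [Germ.coe_eq.1 this] with b hb _ using hb
      · exact Filter.Eventually.of_forall fun b h' => absurd h' h
  obtain ⟨b, hb⟩ := ((Filter.eventually_all_finset F).2 hev).exists
  exact ⟨_, hb⟩

/-- Every point over a real closed extension of `ℝ` specializes to an ultrafilter of
real points satisfying the same polynomial sign conditions. -/
theorem exists_ultrafilter_of_point : ∀ (n : ℕ) (x : Fin n → R),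
    ∃ φ : Ultrafilter (Fin n → ℝ), ∀ f : MvPolynomial (Fin n) ℝ,
      (0 < MvPolynomial.aeval x f → ∀ᶠ b in φ, 0 < MvPolynomial.eval b f) ∧
      (MvPolynomial.aeval x f = 0 → ∀ᶠ b in φ, MvPolynomial.eval b f = 0) := by
  classical
  intro n
  induction n with
  | zero =>
    intro x
    refine ⟨pure default, fun f => ?_⟩
    rw [MvPolynomial.eq_C_of_isEmpty f]
    simp only [MvPolynomial.aeval_C, MvPolynomial.eval_C]
    exact ⟨fun h => Filter.Eventually.of_forall fun _ => algebraMap_real_pos_iff.1 h,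
      fun h => Filter.Eventually.of_forall fun _ => (_root_.map_eq_zero _).1 h⟩
  | succ n ih =>
    intro x
    obtain ⟨φ, hφ⟩ := ih (Fin.tail x)
    let S : MvPolynomial (Fin (n + 1)) ℝ → Set (Fin (n + 1) → ℝ) := fun f =>
      {b | (0 < MvPolynomial.aeval x f → 0 < MvPolynomial.eval b f) ∧
        (MvPolynomial.aeval x f = 0 → MvPolynomial.eval b f = 0)}
    have hne : NeBot (Filter.generate (Set.range S)) := by
      rw [Filter.generate_neBot_iff]
      intro t ht htf
      lift t to Finset (Set (Fin (n + 1) → ℝ)) using htf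
      rw [← Set.image_univ, Finset.subset_set_image_iff] at ht
      obtain ⟨F, -, rfl⟩ := ht
      obtain ⟨b, hb⟩ := exists_lift_of_finset x φ hφ F
      refine ⟨b, fun s hs => ?_⟩
      obtain ⟨f, hf, rfl⟩ := Finset.mem_image.1 (Finset.mem_coe.1 hs)
      exact hb f hf
    refine ⟨Ultrafilter.of (Filter.generate (Set.range S)), fun f => ?_⟩
    have : ∀ᶠ b in Ultrafilter.of (Filter.generate (Set.range S)), b ∈ S f :=
      Ultrafilter.of_le _ (Filter.mem_generate_of_mem ⟨f, rfl⟩)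
    exact ⟨fun h => this.mono fun b hb => hb.1 h, fun h => this.mono fun b hb => hb.2 h⟩
end

end

section

theorem exists_eval_of_ringHom {n : ℕ} {R : Type*} [Field R] [LinearOrder R]
    [IsStrictOrderedRing R] [IsRealClosed R] (φ : MvPolynomial (Fin n) ℝ →+* R)
    {p f : MvPolynomial (Fin n) ℝ} (hp : φ p = 0) (hf : φ f ≠ 0) :
    ∃ b : Fin n → ℝ, MvPolynomial.eval b p = 0 ∧ MvPolynomial.eval b f ≠ 0 := by
  let _ : Algebra ℝ R := (φ.comp MvPolynomial.C).toAlgebra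
  have hφ : ∀ g, MvPolynomial.aeval (fun i => φ (MvPolynomial.X i)) g = φ g := by
    intro g
    have : (MvPolynomial.aeval (R := ℝ) (fun i => φ (MvPolynomial.X i))).toRingHom = φ := by
      refine MvPolynomial.ringHom_ext (fun r => ?_) (fun i => ?_)
      · exact MvPolynomial.aeval_C _ _
      · exact MvPolynomial.aeval_X _ _
    exact congrArg (fun ψ : MvPolynomial (Fin n) ℝ →+* R => ψ g) this
  obtain ⟨U, hU⟩ := exists_ultrafilter_of_point n (fun i => φ (MvPolynomial.X i))
  have h1 := (hU p).2 (by rw [hφ, hp])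
  have h2 : 0 < MvPolynomial.aeval (fun i => φ (MvPolynomial.X i)) (f * f) := by
    rw [hφ, map_mul]
    exact mul_self_pos.2 hf
  obtain ⟨b, hb1, hb2⟩ := (h1.and ((hU _).1 h2)).exists
  refine ⟨b, hb1, fun h => ?_⟩
  rw [map_mul, h, mul_zero] at hb2
  exact lt_irrefl _ hb2

theorem isSemireal_fractionRing_quotient {n : ℕ} {I : Ideal (MvPolynomial (Fin n) ℝ)}
    [I.IsPrime] (hI : IsRealIdeal I) : IsSemireal (FractionRing (MvPolynomial (Fin n) ℝ ⧸ I)) := by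
  let D := MvPolynomial (Fin n) ℝ ⧸ I
  let K := FractionRing D
  let ι : MvPolynomial (Fin n) ℝ →+* K := (algebraMap D K).comp (Ideal.Quotient.mk I)
  have hι : ∀ a, ι a = 0 ↔ a ∈ I := by
    intro a
    rw [← Ideal.Quotient.eq_zero_iff_mem]
    exact map_eq_zero_iff _ (IsFractionRing.injective D K)
  have key : ∀ s : K, IsSumSq s → ∃ (ℓ : ℕ) (a : Fin ℓ → MvPolynomial (Fin n) ℝ)
      (b : MvPolynomial (Fin n) ℝ), b ∉ I ∧ s * ι b ^ 2 = ∑ j, ι (a j) ^ 2 := by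
    intro s hs
    induction hs with
    | zero =>
      exact ⟨0, Fin.elim0, 1, (Ideal.ne_top_iff_one I).1 (Ideal.IsPrime.ne_top ‹_›), by simp⟩
    | sq_add x hs ih =>
      obtain ⟨ℓ, a, b, hb, h⟩ := ih
      obtain ⟨u, v, hv, rfl⟩ := IsFractionRing.div_surjective (A := D) x
      obtain ⟨u, rfl⟩ := Ideal.Quotient.mk_surjective u
      obtain ⟨v, rfl⟩ := Ideal.Quotient.mk_surjective v
      have hv0 : v ∉ I := fun h' =>
        nonZeroDivisors.ne_zero hv (Ideal.Quotient.eq_zero_iff_mem.2 h')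
      have hv1 : ι v ≠ 0 := fun h' => hv0 ((hι v).1 h')
      refine ⟨ℓ + 1, Fin.cons (u * b) (fun j => v * a j), v * b,
        fun h' => (Ideal.IsPrime.mem_or_mem ‹_› h').elim hv0 hb, ?_⟩
      rw [Fin.sum_univ_succ]
      simp only [Fin.cons_zero, Fin.cons_succ, map_mul, mul_pow]
      rw [← Finset.mul_sum, ← h]
      change (ι u / ι v * (ι u / ι v) + _) * _ = _
      have hw : ι u / ι v * ι v = ι u := div_mul_cancel₀ _ hv1
      generalize ι u / ι v = w at hw ⊢
      rw [← hw]
      ring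
  rw [isSemireal_iff_not_isSumSq_neg_one]
  intro h
  obtain ⟨ℓ, a, b, hb, h⟩ := key _ h
  apply hb
  refine hI (ℓ + 1) (Fin.cons b a) ?_ 0
  rw [← hι, map_sum, Fin.sum_univ_succ]
  simp only [Fin.cons_zero, Fin.cons_succ, map_pow]
  rw [← h]
  ring

theorem exists_eval_of_isRealIdeal {n : ℕ} {I : Ideal (MvPolynomial (Fin n) ℝ)}
    [I.IsPrime] (hI : IsRealIdeal I) {p f : MvPolynomial (Fin n) ℝ} (hp : p ∈ I)
    (hf : f ∉ I) : ∃ b : Fin n → ℝ, MvPolynomial.eval b p = 0 ∧ MvPolynomial.eval b f ≠ 0 := by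
  have := isSemireal_fractionRing_quotient hI
  obtain ⟨E, _, _, _⟩ := exists_isRealClosed_extension (FractionRing (MvPolynomial (Fin n) ℝ ⧸ I))
  refine exists_eval_of_ringHom (((algebraMap _ E).comp (algebraMap (MvPolynomial (Fin n) ℝ ⧸ I)
    (FractionRing (MvPolynomial (Fin n) ℝ ⧸ I)))).comp (Ideal.Quotient.mk I)) ?_ ?_
  · simp [Ideal.Quotient.eq_zero_iff_mem.2 hp]
  · simp only [RingHom.comp_apply]
    rw [_root_.map_ne_zero, ne_eq, map_eq_zero_iff _ (IsFractionRing.injective _ _),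
      Ideal.Quotient.eq_zero_iff_mem]
    exact hf
end

section

namespace MvPolynomial

variable {σ K : Type*} [Field K]

theorem totalDegree_pderiv_lt {i : σ} {p : MvPolynomial σ K} (h : pderiv i p ≠ 0) :
    (pderiv i p).totalDegree < p.totalDegree := by
  classical
  have key : ∀ m ∈ (pderiv i p).support, (m.sum fun _ e => e) + 1 ≤ p.totalDegree := by
    intro m hm
    have h1 : m + Finsupp.single i 1 ∈ p.support := by
      rw [mem_support_iff, coeff_pderiv] at hm
      exact mem_support_iff.2 (left_ne_zero_of_mul hm)
    have h2 := le_totalDegree h1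
    rwa [Finsupp.sum_add_index' (fun _ => rfl) (fun _ _ _ => rfl),
      Finsupp.sum_single_index rfl] at h2
  obtain ⟨m, hm⟩ := support_nonempty.2 h
  rw [totalDegree, Finset.sup_lt_iff (lt_of_lt_of_le (Nat.succ_pos _) (key m hm))]
  exact key

theorem not_dvd_pderiv {i : σ} {p : MvPolynomial σ K} (h : pderiv i p ≠ 0) :
    ¬ p ∣ pderiv i p := by
  rintro ⟨q, hq⟩
  have hp : p ≠ 0 := by rintro rfl; simp at h
  have hq0 : q ≠ 0 := by rintro rfl; rw [mul_zero] at hq; exact h hq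
  have := totalDegree_pderiv_lt h
  rw [hq, totalDegree_mul_of_isDomain hp hq0] at this
  omega

theorem eq_C_of_pderiv_eq_zero [CharZero K] {p : MvPolynomial σ K}
    (h : ∀ i, pderiv i p = 0) : p = C (coeff 0 p) := by
  classical
  ext m
  rw [coeff_C]
  split_ifs with hm
  · rw [hm]
  obtain ⟨i, hi⟩ := Finsupp.ne_iff.1 (Ne.symm hm)
  have h1 := coeff_pderiv (i := i) p (m - Finsupp.single i 1)
  rw [h i, coeff_zero, tsub_add_cancel_of_le
    (Finsupp.single_le_iff.2 (Nat.one_le_iff_ne_zero.2 hi))] at h1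
  exact (mul_eq_zero.1 h1.symm).resolve_right (Nat.cast_add_one_ne_zero _)

theorem exists_pderiv_ne_zero [CharZero K] {p : MvPolynomial σ K} (hp : Irreducible p) :
    ∃ i, pderiv i p ≠ 0 := by
  by_contra! h
  have h1 := eq_C_of_pderiv_eq_zero h
  have h2 : coeff 0 p ≠ 0 := fun h0 => hp.ne_zero (by rw [h1, h0, C_0])
  exact hp.not_isUnit (by rw [h1]; exact (Ne.isUnit h2).map C)

/-- The differential of a polynomial function. -/
noncomputable def evalDeriv {𝕜 ι : Type*} [RCLike 𝕜] [Fintype ι] (p : MvPolynomial ι 𝕜)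
    (x : ι → 𝕜) : (ι → 𝕜) →L[𝕜] 𝕜 :=
  ∑ i, eval x (pderiv i p) • ContinuousLinearMap.proj (R := 𝕜) (φ := fun _ : ι => 𝕜) i

theorem evalDeriv_apply {𝕜 ι : Type*} [RCLike 𝕜] [Fintype ι] (p : MvPolynomial ι 𝕜)
    (x v : ι → 𝕜) : evalDeriv p x v = ∑ i, eval x (pderiv i p) * v i := by
  rw [evalDeriv, _root_.sum_apply]
  rfl

theorem hasStrictFDerivAt_eval {𝕜 ι : Type*} [RCLike 𝕜] [Fintype ι] (p : MvPolynomial ι 𝕜)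
    (x : ι → 𝕜) : HasStrictFDerivAt (fun y : ι → 𝕜 => eval y p) (evalDeriv p x) x := by
  classical
  induction p using MvPolynomial.induction_on with
  | C a =>
    simp only [eval_C]
    refine (hasStrictFDerivAt_const (𝕜 := 𝕜) a x).congr_fderiv ?_
    ext v
    simp [evalDeriv_apply]
  | add p q hp hq =>
    simp only [map_add]
    refine (hp.add hq).congr_fderiv ?_
    ext v
    simp [evalDeriv_apply, add_mul, Finset.sum_add_distrib]
  | mul_X p i hp =>
    have h := hp.mul (hasStrictFDerivAt_apply (𝕜 := 𝕜) (F' := fun _ : ι => 𝕜) i x)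
    simp only [map_mul, eval_X]
    refine h.congr_fderiv ?_
    ext v
    simp only [_root_.add_apply, _root_.smul_apply, evalDeriv_apply,
      ContinuousLinearMap.proj_apply, smul_eq_mul, add_mul, Finset.sum_add_distrib,
      Finset.mul_sum, pderiv_mul, pderiv_X, map_add, map_mul, eval_X]
    rw [add_comm]
    congr 1
    · exact Finset.sum_congr rfl fun j _ => by ring
    · rw [Finset.sum_eq_single i]
      · simp
      · intro j _ hj
        simp [hj.symm]
      · simp

end MvPolynomial

open MvPolynomial

theorem exists_sign_change {ι : Type*} [Fintype ι] [DecidableEq ι] {p : MvPolynomial ι ℝ}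
    {b : ι → ℝ} {i : ι} (hb : eval b p = 0) (h : eval b (pderiv i p) ≠ 0) :
    ∃ s t : ℝ, eval (Function.update b i s) p < 0 ∧ 0 < eval (Function.update b i t) p := by
  have hd : HasDerivAt (fun s => eval (Function.update b i s) p) (eval b (pderiv i p)) (b i) := by
    have h1 : HasFDerivAt (fun y : ι → ℝ => eval y p) (evalDeriv p b)
        (Function.update b i (b i)) := by
      rw [Function.update_eq_self]
      exact (hasStrictFDerivAt_eval p b).hasFDerivAt
    refine (h1.comp_hasDerivAt (b i) (hasDerivAt_update b i (b i))).congr_deriv ?_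
    simp [evalDeriv_apply, Pi.single_apply]
  have hbi : eval (Function.update b i (b i)) p = 0 := by rw [Function.update_eq_self, hb]
  by_contra! hcon
  by_cases h1 : ∃ s, eval (Function.update b i s) p < 0
  · obtain ⟨s, hs⟩ := h1
    have hmax : IsLocalMax (fun s => eval (Function.update b i s) p) (b i) := by
      refine Filter.Eventually.of_forall fun t => ?_
      exact (hcon s t hs).trans hbi.ge
    exact h (hmax.hasDerivAt_eq_zero hd)
  · push Not at h1
    have hmin : IsLocalMin (fun s => eval (Function.update b i s) p) (b i) := by
      refine Filter.Eventually.of_forall fun t => ?_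
      exact hbi.le.trans (h1 t)
    exact h (hmin.hasDerivAt_eq_zero hd)

/-- If `p` vanishes at a real point where a partial derivative does not, then the real zero
set of `p` has dimension at least `d - 1`. -/
theorem le_dimH_zeros {d : ℕ} {p : MvPolynomial (Fin d) ℝ} {b : Fin d → ℝ} {i : Fin d}
    (hb : eval b p = 0) (h : eval b (pderiv i p) ≠ 0) :
    ((d - 1 : ℕ) : ENNReal) ≤ dimH {x : Fin d → ℝ | eval x p = 0} := by
  obtain ⟨n, rfl⟩ : ∃ n, d = n + 1 := ⟨d - 1, by have := i.pos; omega⟩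
  obtain ⟨s, t, hs, ht⟩ := exists_sign_change hb h
  obtain ⟨ins, hins⟩ : ∃ ins : ℝ → (Fin n → ℝ) → (Fin (n + 1) → ℝ),
      ins = fun r y => i.insertNth (α := fun _ => ℝ) r y := ⟨_, rfl⟩
  let π : (Fin (n + 1) → ℝ) → Fin n → ℝ := fun x j => x (i.succAbove j)
  have hπ : LipschitzWith 1 π := LipschitzWith.of_dist_le_mul fun x y => by
    rw [NNReal.coe_one, one_mul]
    exact (dist_pi_le_iff dist_nonneg).2 fun j => dist_le_pi_dist x y _
  have hπins : ∀ r y, π (ins r y) = y := fun r y => by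
    ext j
    simp [π, hins]
  have hupd : ∀ r, ins r (π b) = Function.update b i r := by
    intro r
    rw [hins]
    simp only
    rw [Fin.insertNth_eq_iff]
    refine ⟨by simp, ?_⟩
    ext j
    simp [π, Fin.removeNth]
  have hinsc : Continuous fun z : ℝ × (Fin n → ℝ) => ins z.1 z.2 := by
    rw [hins]
    fun_prop
  have hc : Continuous fun z : ℝ × (Fin n → ℝ) => eval (ins z.1 z.2) p :=
    (MvPolynomial.continuous_eval p).comp hinsc
  let U : Set (Fin n → ℝ) := {y | eval (ins s y) p < 0 ∧ 0 < eval (ins t y) p}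
  have hU : IsOpen U := by
    refine IsOpen.inter ?_ ?_
    · exact isOpen_lt (hc.comp (Continuous.prodMk_right s)) continuous_const
    · exact isOpen_lt continuous_const (hc.comp (Continuous.prodMk_right t))
  have hne : U.Nonempty := ⟨π b, by rw [hupd]; exact hs, by rw [hupd]; exact ht⟩
  have hsub : U ⊆ π '' {x | eval x p = 0} := by
    rintro y ⟨h1, h2⟩
    have hcy : Continuous fun r : ℝ => eval (ins r y) p := hc.comp (Continuous.prodMk_left y)
    obtain ⟨r, hr⟩ := mem_range_of_exists_le_of_exists_ge hcy ⟨s, h1.le⟩ ⟨t, h2.le⟩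
    exact ⟨ins r y, hr, hπins r y⟩
  have hdimU : dimH U = n := by
    rw [Real.dimH_of_nonempty_interior (by rwa [hU.interior_eq]), Module.finrank_fin_fun]
  calc ((n + 1 - 1 : ℕ) : ENNReal) = dimH U := hdimU.symm
    _ ≤ dimH (π '' {x | eval x p = 0}) := dimH_mono hsub
    _ ≤ dimH {x : Fin (n + 1) → ℝ | eval x p = 0} := hπ.dimH_image_le _

theorem le_dimH_zeros_of_isRealIdeal {d : ℕ} {p : MvPolynomial (Fin d) ℝ}
    (hp : Irreducible p) (hreal : IsRealIdeal (Ideal.span {p})) :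
    ((d - 1 : ℕ) : ENNReal) ≤ dimH {x : Fin d → ℝ | eval x p = 0} := by
  obtain ⟨i, hi⟩ := exists_pderiv_ne_zero hp
  have : (Ideal.span {p}).IsPrime := (Ideal.span_singleton_prime hp.ne_zero).2 hp.prime
  obtain ⟨b, hb, hb'⟩ := exists_eval_of_isRealIdeal hreal (Ideal.mem_span_singleton_self p)
    (f := pderiv i p) (fun h => not_dvd_pderiv hi (Ideal.mem_span_singleton.1 h))
  exact le_dimH_zeros hb hb'
end

section

open MvPolynomial

theorem MvPolynomial.exists_map_add_I_mul_map {σ : Type*} (f : MvPolynomial σ ℂ) :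
    ∃ g h : MvPolynomial σ ℝ,
      f = map Complex.ofRealHom g + C Complex.I * map Complex.ofRealHom h := by
  induction f using MvPolynomial.induction_on with
  | C a =>
    refine ⟨C a.re, C a.im, ?_⟩
    rw [map_C, map_C, ← C_mul, ← C_add]
    congr 1
    change a = (a.re : ℂ) + Complex.I * (a.im : ℂ)
    rw [mul_comm, Complex.re_add_im]
  | add p q hp hq =>
    obtain ⟨g, h, rfl⟩ := hp
    obtain ⟨g', h', rfl⟩ := hq
    exact ⟨g + g', h + h', by simp only [map_add]; ring⟩
  | mul_X p i hp =>
    obtain ⟨g, h, rfl⟩ := hp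
    exact ⟨g * X i, h * X i, by simp only [map_mul, map_X]; ring⟩

theorem eval_realToComplex_map {d : ℕ} (a : Fin d → ℝ) (g : MvPolynomial (Fin d) ℝ) :
    eval (realToComplex a) (map Complex.ofRealHom g) = (eval a g : ℂ) := by
  rw [eval_map]
  exact (eval₂_comp Complex.ofRealHom a g).symm

theorem complexification_zeros {d : ℕ} {p : MvPolynomial (Fin d) ℝ}
    (hp : Irreducible p) (hreal : IsRealIdeal (Ideal.span {p})) :
    complexification {x : Fin d → ℝ | eval x p = 0} =
      {z | eval z (map Complex.ofRealHom p) = 0} := by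
  have : (Ideal.span {p}).IsPrime := (Ideal.span_singleton_prime hp.ne_zero).2 hp.prime
  have hvanish : ∀ g : MvPolynomial (Fin d) ℝ, (∀ a, eval a p = 0 → eval a g = 0) → p ∣ g := by
    intro g hg
    by_contra h
    obtain ⟨b, hb, hb'⟩ := exists_eval_of_isRealIdeal hreal (Ideal.mem_span_singleton_self p)
      (f := g) (fun h' => h (Ideal.mem_span_singleton.1 h'))
    exact hb' (hg b hb)
  ext z
  constructor
  · intro hz
    refine hz _ ?_
    rintro _ ⟨a, ha, rfl⟩
    rw [eval_realToComplex_map, show eval a p = 0 from ha, Complex.ofReal_zero]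
  · intro hz f hf
    obtain ⟨g, h, rfl⟩ := MvPolynomial.exists_map_add_I_mul_map f
    have key : ∀ a, eval a p = 0 → eval a g = 0 ∧ eval a h = 0 := by
      intro a ha
      have h1 := hf _ ⟨a, ha, rfl⟩
      rw [map_add, map_mul, eval_C, eval_realToComplex_map, eval_realToComplex_map] at h1
      constructor
      · simpa using congrArg Complex.re h1
      · simpa using congrArg Complex.im h1
    obtain ⟨u, rfl⟩ := hvanish g fun a ha => (key a ha).1
    obtain ⟨v, rfl⟩ := hvanish h fun a ha => (key a ha).2
    have hz' : eval z (map Complex.ofRealHom p) = 0 := hz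
    simp only [map_add, map_mul, hz', zero_mul, mul_zero, add_zero]
end

section

open MvPolynomial Topology

theorem dimH_coordinate_subspace_le {ι : Type*} [Fintype ι] (S : Finset ι) :
    dimH {w : ι → ℂ | ∀ j ∉ S, w j = 0} ≤ 2 * (S.card : ENNReal) := by
  classical
  let e : (S → ℂ) → ι → ℂ := fun v j => if h : j ∈ S then v ⟨j, h⟩ else 0
  have he : LipschitzWith 1 e := LipschitzWith.of_dist_le_mul fun v w => by
    rw [NNReal.coe_one, one_mul]
    refine (dist_pi_le_iff dist_nonneg).2 fun j => ?_
    by_cases h : j ∈ S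
    · simp only [e, dif_pos h]
      exact dist_le_pi_dist v w _
    · simp only [e, dif_neg h, dist_self]
      exact dist_nonneg
  have hsub : {w : ι → ℂ | ∀ j ∉ S, w j = 0} ⊆ e '' Set.univ := by
    intro w hw
    refine ⟨fun j => w j, trivial, ?_⟩
    ext j
    by_cases h : j ∈ S
    · simp only [e, dif_pos h]
    · simp only [e, dif_neg h, hw j h]
  have hfin : Module.finrank ℝ (S → ℂ) = 2 * S.card := by
    rw [Module.finrank_pi_fintype]
    simp [Complex.finrank_real_complex, mul_comm]
  calc _ ≤ dimH (e '' Set.univ) := dimH_mono hsub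
    _ ≤ dimH (Set.univ : Set (S → ℂ)) := he.dimH_image_le _
    _ = _ := by rw [Real.dimH_univ_eq_finrank, hfin]; push_cast; rfl

theorem exists_nhds_dimH_inter_le {E : Type*} [NormedAddCommGroup E] [NormedSpace ℂ E]
    [FiniteDimensional ℂ E] {G : E → E} {L : E →L[ℂ] E} {z : E}
    (hG : HasStrictFDerivAt G L z) (hL : Function.Injective L) {A T : Set E}
    (hAT : Set.MapsTo G A T) : ∃ U ∈ 𝓝 z, dimH (A ∩ U) ≤ dimH T := by
  have : CompleteSpace E := FiniteDimensional.complete ℂ E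
  let e : E ≃L[ℂ] E := (LinearEquiv.ofInjectiveEndo (L : E →ₗ[ℂ] E) hL).toContinuousLinearEquiv
  have hG' : HasStrictFDerivAt G (e : E →L[ℂ] E) z := hG.congr_fderiv (by ext; rfl)
  obtain ⟨K, s, hs, hK⟩ := hG'.to_localInverse.exists_lipschitzOnWith
  refine ⟨{x | hG'.localInverse G e z (G x) = x} ∩ G ⁻¹' s,
    Filter.inter_mem hG'.eventually_left_inverse (hG.continuousAt hs), ?_⟩
  calc _ ≤ dimH (hG'.localInverse G e z '' (T ∩ s)) :=
        dimH_mono fun x hx => ⟨G x, ⟨hAT hx.1, hx.2.2⟩, hx.2.1⟩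
    _ ≤ dimH (T ∩ s) := (hK.mono Set.inter_subset_right).dimH_image_le
    _ ≤ dimH T := dimH_mono Set.inter_subset_left

theorem dimH_le_of_forall_exists_nhds {E : Type*} [EMetricSpace E] [SecondCountableTopology E]
    {A : Set E} {r : ENNReal} (h : ∀ x ∈ A, ∃ U ∈ 𝓝 x, dimH (A ∩ U) ≤ r) : dimH A ≤ r := by
  by_contra! hlt
  obtain ⟨x, hx, hx'⟩ := exists_mem_nhdsWithin_lt_dimH_of_lt_dimH hlt
  obtain ⟨U, hU, hle⟩ := h x hx
  exact absurd (hx' _ (inter_mem_nhdsWithin A hU)) (not_lt.2 hle)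

variable {ι : Type*}

/-- The coordinates in `S` are algebraically independent modulo `I`. -/
def IndepModulo {K : Type*} [Field K] (I : Ideal (MvPolynomial ι K)) (S : Finset ι) : Prop :=
  ∀ g ∈ I, g.vars ⊆ S → g = 0

theorem vars_pderiv_subset {K : Type*} [Field K] (i : ι) (p : MvPolynomial ι K) :
    (pderiv i p).vars ⊆ p.vars := by
  classical
  intro j hj
  rw [mem_vars_iff_mem_support] at hj ⊢
  obtain ⟨m, hm, hjm⟩ := hj
  rw [mem_support_iff, coeff_pderiv] at hm
  refine ⟨_, mem_support_iff.2 (left_ne_zero_of_mul hm), ?_⟩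
  rw [Finsupp.mem_support_iff] at hjm ⊢
  simp only [Finsupp.add_apply]
  omega

theorem notMem_vars_of_pderiv_eq_zero {K : Type*} [Field K] [CharZero K] {i : ι}
    {p : MvPolynomial ι K} (h : pderiv i p = 0) : i ∉ p.vars := by
  classical
  intro hi
  obtain ⟨m, hm, him⟩ := (mem_vars_iff_mem_support i).1 hi
  have h1 := coeff_pderiv (i := i) p (m - Finsupp.single i 1)
  rw [h, coeff_zero, tsub_add_cancel_of_le
    (Finsupp.single_le_iff.2 (Nat.one_le_iff_ne_zero.2 (Finsupp.mem_support_iff.1 him)))] at h1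
  exact mem_support_iff.1 hm
    ((mul_eq_zero.1 h1.symm).resolve_right (Nat.cast_add_one_ne_zero _))

theorem exists_pderiv_notMem [DecidableEq ι] {K : Type*} [Field K] [CharZero K]
    {I : Ideal (MvPolynomial ι K)} {S : Finset ι} (hS : IndepModulo I S) {j : ι}
    (hj : ¬ IndepModulo I (insert j S)) :
    ∃ g ∈ I, g.vars ⊆ insert j S ∧ pderiv j g ∉ I := by
  have hex : ∃ n : ℕ, ∃ g ∈ I, g.vars ⊆ insert j S ∧ g ≠ 0 ∧ g.totalDegree = n := by
    simp only [IndepModulo] at hj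
    push Not at hj
    obtain ⟨g, h1, h2, h3⟩ := hj
    exact ⟨_, g, h1, h2, h3, rfl⟩
  classical
  obtain ⟨g, hgI, hgS, hg0, hgn⟩ := Nat.find_spec hex
  refine ⟨g, hgI, hgS, fun hmem => ?_⟩
  by_cases h0 : pderiv j g = 0
  · refine hg0 (hS g hgI fun i hi => ?_)
    rcases Finset.mem_insert.1 (hgS hi) with rfl | h
    · exact absurd hi (notMem_vars_of_pderiv_eq_zero h0)
    · exact h
  · refine Nat.find_min hex (m := (pderiv j g).totalDegree) ?_
      ⟨_, hmem, (vars_pderiv_subset j g).trans hgS, h0, rfl⟩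
    rw [← hgn]
    exact totalDegree_pderiv_lt h0

variable [Fintype ι]

theorem exists_nhds_dimH_zeroLocus_inter_le [DecidableEq ι] {I : Ideal (MvPolynomial ι ℂ)}
    {S : Finset ι} {g : ι → MvPolynomial ι ℂ} (hg : ∀ j ∉ S, g j ∈ I)
    (hvars : ∀ j ∉ S, (g j).vars ⊆ insert j S) {z : ι → ℂ}
    (hz : ∀ j ∉ S, eval z (pderiv j (g j)) ≠ 0) :
    ∃ U ∈ 𝓝 z, dimH (zeroLocus ℂ I ∩ U) ≤ 2 * (S.card : ENNReal) := by
  let q : ι → MvPolynomial ι ℂ := fun i => if i ∈ S then X i else g i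
  let L : (ι → ℂ) →L[ℂ] (ι → ℂ) := ContinuousLinearMap.pi fun i => evalDeriv (q i) z
  have hG : HasStrictFDerivAt (fun (x : ι → ℂ) i => eval x (q i)) L z :=
    hasStrictFDerivAt_pi.2 fun i => hasStrictFDerivAt_eval (q i) z
  have hL : Function.Injective L := by
    rw [injective_iff_map_eq_zero]
    intro v hv
    have hv' : ∀ i, ∑ k, eval z (pderiv k (q i)) * v k = 0 := by
      intro i
      rw [← evalDeriv_apply]
      exact congrFun hv i
    have hvS : ∀ i ∈ S, v i = 0 := by
      intro i hi
      have := hv' i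
      simp only [q, if_pos hi, pderiv_X] at this
      rw [Finset.sum_eq_single i (by intro k _ hk; simp [hk.symm]) (by simp)] at this
      simpa using this
    ext j
    by_cases hj : j ∈ S
    · exact hvS j hj
    · have := hv' j
      simp only [q, if_neg hj] at this
      rw [Finset.sum_eq_single j ?_ (by simp)] at this
      · exact (mul_eq_zero.1 this).resolve_left (hz j hj)
      · intro k _ hk
        by_cases hkS : k ∈ S
        · rw [hvS k hkS, mul_zero]
        · rw [pderiv_eq_zero_of_notMem_vars (fun h => (Finset.mem_insert.1 (hvars j hj h)).elim
            hk hkS), map_zero, zero_mul]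
  obtain ⟨U, hU, hle⟩ := exists_nhds_dimH_inter_le hG hL (A := zeroLocus ℂ I)
    (T := {w : ι → ℂ | ∀ j ∉ S, w j = 0}) (fun x hx j hj => by
      simp only [q, if_neg hj]
      exact hx _ (hg j hj))
  exact ⟨U, hU, hle.trans (dimH_coordinate_subspace_le S)⟩

theorem dimH_zeroLocus_le (n : ℕ) (I : Ideal (MvPolynomial ι ℂ))
    (hn : ∀ S, IndepModulo I S → S.card ≤ n) : dimH (zeroLocus ℂ I) ≤ 2 * (n : ENNReal) := by
  classical
  induction I using WellFoundedGT.induction with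
  | ind I ih =>
  have hmono : ∀ J, I < J → dimH (zeroLocus ℂ J) ≤ 2 * (n : ENNReal) := fun J hJ =>
    ih J hJ fun S hS => hn S fun g hg => hS g (hJ.le hg)
  have hadd : ∀ f, f ∉ I → dimH (zeroLocus ℂ I ∩ {z | eval z f = 0}) ≤ 2 * (n : ENNReal) := by
    intro f hf
    refine (dimH_mono ?_).trans (hmono (I ⊔ Ideal.span {f}) (left_lt_sup.2 fun h =>
      hf (h (Ideal.mem_span_singleton_self f))))
    rintro z ⟨hz, hz'⟩ p hp
    obtain ⟨a, ha, b, hb, rfl⟩ := Submodule.mem_sup.1 hp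
    obtain ⟨c, rfl⟩ := Ideal.mem_span_singleton'.1 hb
    rw [map_add, map_mul, hz a ha, show aeval z f = 0 from hz', mul_zero, add_zero]
  by_cases htop : I = ⊤
  · rw [htop, zeroLocus_top]
    simp
  by_cases hprime : I.IsPrime
  · obtain ⟨S, hS, hmax⟩ : ∃ S : Finset ι, IndepModulo I S ∧
        ∀ j ∉ S, ¬ IndepModulo I (insert j S) := by
      have h0 : IndepModulo I (∅ : Finset ι) := by
        intro g hg hv
        rw [Finset.subset_empty, vars_eq_empty_iff_eq_C] at hv
        by_contra h0
        refine htop (Ideal.eq_top_of_isUnit_mem _ hg ?_)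
        rw [hv] at h0 ⊢
        exact (Ne.isUnit fun h => h0 (by rw [h, C_0])).map C
      obtain ⟨S, hS⟩ := (Set.toFinite {S : Finset ι | IndepModulo I S}).exists_maximal ⟨_, h0⟩
      refine ⟨S, hS.prop, fun j hj h => hj ?_⟩
      exact hS.le_of_ge h (Finset.subset_insert j S) (Finset.mem_insert_self j S)
    have hg : ∀ j, ∃ g, j ∉ S → g ∈ I ∧ g.vars ⊆ insert j S ∧ pderiv j g ∉ I := by
      intro j
      by_cases hj : j ∈ S
      · exact ⟨0, fun h => absurd hj h⟩
      · obtain ⟨g, h⟩ := exists_pderiv_notMem hS (hmax j hj)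
        exact ⟨g, fun _ => h⟩
    choose g hg using hg
    let f := ∏ j ∈ Finset.univ \ S, pderiv j (g j)
    have hf : f ∉ I := by
      intro h
      obtain ⟨j, hj, h'⟩ := hprime.prod_mem_iff.1 h
      exact (hg j (Finset.mem_sdiff.1 hj).2).2.2 h'
    have hcover : zeroLocus ℂ I ⊆ (zeroLocus ℂ I ∩ {z | eval z f = 0}) ∪
        (zeroLocus ℂ I ∩ {z | eval z f ≠ 0}) := fun z hz => by
      by_cases h : eval z f = 0
      · exact Or.inl ⟨hz, h⟩
      · exact Or.inr ⟨hz, h⟩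
    refine (dimH_mono hcover).trans ?_
    rw [dimH_union]
    refine max_le (hadd f hf) (dimH_le_of_forall_exists_nhds ?_)
    rintro z ⟨hz, hzf⟩
    obtain ⟨U, hU, hle⟩ := exists_nhds_dimH_zeroLocus_inter_le (I := I) (S := S) (g := g) (z := z)
      (fun j hj => (hg j hj).1) (fun j hj => (hg j hj).2.1) (fun j hj h0 => hzf (by
        rw [map_prod]
        exact Finset.prod_eq_zero (Finset.mem_sdiff.2 ⟨Finset.mem_univ j, hj⟩) h0))
    refine ⟨U, hU, (dimH_mono ?_).trans (hle.trans ?_)⟩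
    · exact Set.inter_subset_inter_left _ Set.inter_subset_left
    · gcongr
      exact hn S hS
  · rw [Ideal.isPrime_iff] at hprime
    push Not at hprime
    obtain ⟨a, b, hab, ha, hb⟩ := hprime htop
    have hcover : zeroLocus ℂ I ⊆ (zeroLocus ℂ I ∩ {z | eval z a = 0}) ∪
        (zeroLocus ℂ I ∩ {z | eval z b = 0}) := fun z hz => by
      have h := hz _ hab
      rw [map_mul] at h
      exact (mul_eq_zero.1 h).imp (fun h => ⟨hz, h⟩) (fun h => ⟨hz, h⟩)
    refine (dimH_mono hcover).trans ?_
    rw [dimH_union]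
    exact max_le (hadd a ha) (hadd b hb)
end

section

open nonZeroDivisors

theorem Polynomial.exists_C_mem_span_pair {B : Type*} [CommRing B] [IsDomain B] [IsGCDMonoid B]
    {p q : Polynomial B} (hp : Irreducible p) (hpq : ¬ p ∣ q) :
    ∃ b : B, b ≠ 0 ∧ Polynomial.C b ∈ Ideal.span {p, q} := by
  by_cases hp0 : p.natDegree = 0
  · rw [Polynomial.natDegree_eq_zero] at hp0
    obtain ⟨b, rfl⟩ := hp0
    exact ⟨b, fun h => hp.ne_zero (by rw [h, Polynomial.C_0]), Ideal.subset_span (by simp)⟩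
  have hpp := hp.isPrimitive hp0
  let F := FractionRing B
  have hirr : Irreducible (p.map (algebraMap B F)) :=
    hpp.irreducible_iff_irreducible_map_fraction_map.1 hp
  obtain ⟨u, v, huv⟩ := (hirr.coprime_iff_not_dvd (n := q.map (algebraMap B F))).2
    fun h => hpq (hpp.dvd_of_fraction_map_dvd_fraction_map h)
  obtain ⟨a, ha, hu⟩ := IsLocalization.integerNormalization_spec B⁰ u
  obtain ⟨b, hb, hv⟩ := IsLocalization.integerNormalization_spec B⁰ v
  refine ⟨a * b, mul_ne_zero (nonZeroDivisors.ne_zero ha) (nonZeroDivisors.ne_zero hb), ?_⟩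
  have h : Polynomial.C (a * b) = Polynomial.C b * IsLocalization.integerNormalization B⁰ u * p +
      Polynomial.C a * IsLocalization.integerNormalization B⁰ v * q := by
    apply Polynomial.map_injective (algebraMap B F) (IsFractionRing.injective _ _)
    simp only [Polynomial.map_add, Polynomial.map_mul, Polynomial.map_C, hu, hv,
      Algebra.smul_def, Polynomial.algebraMap_apply, RingHom.map_mul]
    linear_combination (-(Polynomial.C (algebraMap B F a) * Polynomial.C (algebraMap B F b))) * huv
  rw [h]
  exact add_mem (Ideal.mul_mem_left _ _ (Ideal.subset_span (by simp)))
    (Ideal.mul_mem_left _ _ (Ideal.subset_span (by simp)))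

open MvPolynomial

theorem MvPolynomial.exists_mem_span_pair_notMem_vars {σ K : Type*} [DecidableEq σ] [Field K]
    {p q : MvPolynomial σ K} (hp : Irreducible p) (hpq : ¬ p ∣ q) (i : σ) :
    ∃ g ∈ Ideal.span {p, q}, g ≠ 0 ∧ i ∉ g.vars := by
  let e : MvPolynomial σ K ≃ₐ[K] Polynomial (MvPolynomial {j // j ≠ i} K) :=
    (renameEquiv K (Equiv.optionSubtypeNe i).symm).trans (optionEquivLeft K _)
  have hgcd : IsGCDMonoid (MvPolynomial {j // j ≠ i} K) := ⟨UniqueFactorizationMonoid.toGCDMonoid _⟩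
  obtain ⟨b, hb0, hb⟩ := Polynomial.exists_C_mem_span_pair
    ((MulEquiv.irreducible_iff e).2 hp)
    (fun h => hpq ((map_dvd_iff e).1 h))
  have heb : e (rename Subtype.val b) = Polynomial.C b := by
    change optionEquivLeft K _ (rename _ (rename _ b)) = _
    rw [rename_rename]
    have : ((Equiv.optionSubtypeNe i).symm ∘ Subtype.val : {j // j ≠ i} → _) = some := by
      ext1 j
      exact Equiv.optionSubtypeNe_symm_of_ne j.2
    rw [this]
    clear hb hb0
    induction b using MvPolynomial.induction_on with
    | C a => rw [rename_C, optionEquivLeft_C]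
    | add a c ha hc => simp only [map_add, ha, hc]
    | mul_X a j ha => simp only [map_mul, ha, rename_X, optionEquivLeft_X_some]
  refine ⟨rename Subtype.val b, ?_, ?_, ?_⟩
  · rw [← heb] at hb
    obtain ⟨u, v, h⟩ := Ideal.mem_span_pair.1 hb
    refine Ideal.mem_span_pair.2 ⟨e.symm u, e.symm v, e.injective ?_⟩
    simpa using h
  · exact fun h => hb0 ((map_eq_zero_iff _ (rename_injective _ Subtype.val_injective)).1 h)
  · intro h
    obtain ⟨j, -, hj⟩ := mem_vars_rename _ _ h
    exact j.2 hj

theorem card_le_of_indepModulo {d : ℕ} {P Q : MvPolynomial (Fin d) ℝ} (hP : Irreducible P)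
    (hPQ : ¬ P ∣ Q) {I : Ideal (MvPolynomial (Fin d) ℂ)}
    (hPI : map Complex.ofRealHom P ∈ I) (hQI : map Complex.ofRealHom Q ∈ I) (S : Finset (Fin d))
    (hS : IndepModulo I S) : S.card ≤ d - 2 := by
  by_contra! hcard
  obtain ⟨g, hg, hg0, hgS⟩ : ∃ g ∈ Ideal.span {P, Q}, g ≠ 0 ∧ g.vars ⊆ S := by
    by_cases huniv : S = Finset.univ
    · exact ⟨P, Ideal.subset_span (by simp), hP.ne_zero, by simp [huniv]⟩
    · obtain ⟨i, hi⟩ : ∃ i, i ∉ S := by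
        by_contra! h
        exact huniv (Finset.eq_univ_iff_forall.2 h)
      obtain ⟨g, hg, hg0, hgi⟩ := exists_mem_span_pair_notMem_vars hP hPQ i
      refine ⟨g, hg, hg0, fun j hj => ?_⟩
      by_contra hjS
      have hij : i ≠ j := fun h => hgi (h ▸ hj)
      have h1 : ({i, j} : Finset (Fin d)) ⊆ Finset.univ \ S := by
        intro k hk
        rcases Finset.mem_insert.1 hk with rfl | hk
        · simp [hi]
        · rw [Finset.mem_singleton.1 hk]
          simp [hjS]
      have h2 := Finset.card_le_card h1
      rw [Finset.card_pair hij, Finset.card_univ_sdiff, Fintype.card_fin] at h2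
      omega
  have hgI : map Complex.ofRealHom g ∈ I := by
    obtain ⟨u, v, rfl⟩ := Ideal.mem_span_pair.1 hg
    rw [map_add, map_mul, map_mul]
    exact add_mem (Ideal.mul_mem_left _ _ hPI) (Ideal.mul_mem_left _ _ hQI)
  have h0 := hS _ hgI ((vars_map _ _).trans hgS)
  exact hg0 ((map_eq_zero_iff _ (map_injective _ Complex.ofReal_injective)).1 h0)

end

section

open MvPolynomial

theorem MvPolynomial.le_height_of_isMaximal {K : Type*} [Field K] {n : ℕ}
    (M : Ideal (MvPolynomial (Fin n) K)) [hM : M.IsMaximal] : n ≤ M.height := by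
  induction n with
  | zero => simp
  | succ n ih =>
    let e := (finSuccEquiv K n).toRingEquiv
    let N := M.comap e.symm
    have hN : N.IsMaximal := Ideal.comap_isMaximal_of_equiv e.symm
    let N' := N.comap (Polynomial.C : MvPolynomial (Fin n) K →+* _)
    have hN' : N'.IsMaximal :=
      Polynomial.isMaximal_comap_C_of_isJacobsonRing N
    have hover : N.LiesOver N' := ⟨rfl⟩
    have h := Polynomial.height_eq_height_add_one N' N
    rw [RingEquiv.height_comap] at h
    rw [h]
    push_cast
    gcongr
    exact ih N'
end

section

open MvPolynomial Topology

theorem MvPolynomial.eq_vanishingIdeal_singleton {σ k : Type*} [Field k]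
    {K : Ideal (MvPolynomial σ k)} (hK : K ≠ ⊤) {y : σ → k} (hy : ∀ i, X i - C (y i) ∈ K) :
    K = vanishingIdeal k {y} := by
  have h : Ideal.Quotient.mk K = ((Ideal.Quotient.mk K).comp C).comp (eval y) := by
    refine ringHom_ext (fun r => by simp) fun i => ?_
    simpa using Ideal.Quotient.eq.2 (hy i)
  have hmax : (vanishingIdeal k {y}).IsMaximal := inferInstance
  refine (hmax.eq_of_le hK fun p hp => ?_).symm
  rw [mem_vanishingIdeal_singleton_iff] at hp
  rw [← Ideal.Quotient.eq_zero_iff_mem, h, RingHom.comp_apply, show eval y p = 0 from hp, map_zero]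

variable {d s : ℕ} {I : Ideal (MvPolynomial (Fin d) ℂ)} {φ : Fin s → MvPolynomial (Fin d) ℂ}

theorem exists_mem_zeroLocus_eval_eq
    (hinj : ∀ p : MvPolynomial (Fin s) ℂ, aeval φ p ∈ I → p = 0)
    (hintegral : ((Ideal.Quotient.mk I).comp
      (aeval φ : MvPolynomial (Fin s) ℂ →ₐ[ℂ] _).toRingHom).IsIntegral)
    (y : Fin s → ℂ) : ∃ z ∈ zeroLocus ℂ I, ∀ i, eval z (φ i) = y i := by
  let f := (Ideal.Quotient.mk I).comp (aeval φ : MvPolynomial (Fin s) ℂ →ₐ[ℂ] _).toRingHom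
  let _ : Algebra (MvPolynomial (Fin s) ℂ) (MvPolynomial (Fin d) ℂ ⧸ I) := f.toAlgebra
  have : Algebra.IsIntegral (MvPolynomial (Fin s) ℂ) (MvPolynomial (Fin d) ℂ ⧸ I) := ⟨hintegral⟩
  have hker : RingHom.ker (algebraMap (MvPolynomial (Fin s) ℂ) (MvPolynomial (Fin d) ℂ ⧸ I)) = ⊥ :=
    (RingHom.injective_iff_ker_eq_bot _).1 ((injective_iff_map_eq_zero _).2 fun p hp =>
      hinj p (Ideal.Quotient.eq_zero_iff_mem.1 hp))
  obtain ⟨Q, hQ, hQc⟩ := Ideal.exists_ideal_over_maximal_of_isIntegral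
    (S := MvPolynomial (Fin d) ℂ ⧸ I)
    (vanishingIdeal ℂ {y}) (by rw [hker]; exact bot_le)
  have hmax : (Q.comap (Ideal.Quotient.mk I)).IsMaximal :=
    Ideal.comap_isMaximal_of_surjective _ Ideal.Quotient.mk_surjective
  obtain ⟨z, hz⟩ := eq_vanishingIdeal_singleton_of_isMaximal ℂ hmax
  refine ⟨z, fun p hp => ?_, fun i => ?_⟩
  · rw [← mem_vanishingIdeal_singleton_iff, ← hz, Ideal.mem_comap,
      Ideal.Quotient.eq_zero_iff_mem.2 hp]
    exact Q.zero_mem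
  · have h1 : X i - C (y i) ∈ vanishingIdeal ℂ {y} := by
      rw [mem_vanishingIdeal_singleton_iff]
      simp
    rw [← hQc, Ideal.mem_comap] at h1
    have h2 : aeval φ (X i - C (y i) : MvPolynomial (Fin s) ℂ) ∈ Q.comap (Ideal.Quotient.mk I) := h1
    rw [hz, mem_vanishingIdeal_singleton_iff] at h2
    simpa [sub_eq_zero] using h2

theorem two_mul_le_dimH_zeroLocus
    (hinj : ∀ p : MvPolynomial (Fin s) ℂ, aeval φ p ∈ I → p = 0)
    (hintegral : ((Ideal.Quotient.mk I).comp
      (aeval φ : MvPolynomial (Fin s) ℂ →ₐ[ℂ] _).toRingHom).IsIntegral) :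
    2 * (s : ENNReal) ≤ dimH (zeroLocus ℂ I) := by
  have hfin : Module.finrank ℝ (Fin s → ℂ) = 2 * s := by
    rw [Module.finrank_pi_fintype]
    simp [Complex.finrank_real_complex, mul_comm]
  have huniv : (Set.univ : Set (Fin s → ℂ)) ⊆
      (fun z i => eval z (φ i)) '' zeroLocus ℂ I := fun y _ => by
    obtain ⟨z, hz, h⟩ := exists_mem_zeroLocus_eval_eq hinj hintegral y
    exact ⟨z, hz, funext h⟩
  have hlip : dimH ((fun z i => eval z (φ i)) '' zeroLocus ℂ I) ≤ dimH (zeroLocus ℂ I) := by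
    refine dimH_image_le_of_locally_lipschitzOn fun z _ => ?_
    have hG : HasStrictFDerivAt (fun (x : Fin d → ℂ) i => eval x (φ i))
        (ContinuousLinearMap.pi fun i => evalDeriv (φ i) z) z :=
      hasStrictFDerivAt_pi.2 fun i => hasStrictFDerivAt_eval (φ i) z
    obtain ⟨K, t, ht, hK⟩ := hG.exists_lipschitzOnWith
    exact ⟨K, t, mem_nhdsWithin_of_mem_nhds ht, hK⟩
  have := (dimH_mono huniv).trans hlip
  rw [Real.dimH_univ_eq_finrank, hfin] at this
  exact_mod_cast this

theorem Ideal.exists_mem_of_mem_minimalPrimes {R : Type*} [CommRing R] [IsNoetherianRing R]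
    {I J : Ideal R} (hI : I ∈ J.minimalPrimes) :
    ∃ h ∉ I, ∀ q ∈ J.minimalPrimes, q ≠ I → h ∈ q := by
  classical
  have := hI.1.1
  by_contra! hcon
  have hle : ((J.finite_minimalPrimes_of_isNoetherianRing.toFinset.erase I).inf id) ≤ I := by
    intro x hx
    by_contra hxI
    obtain ⟨q, hq, hqI, hxq⟩ := hcon x hxI
    refine hxq ((Finset.inf_le (f := id) ?_ : _ ≤ q) hx)
    simp [hq, hqI]
  obtain ⟨q, hq, hqI⟩ := (Ideal.IsPrime.inf_le' ‹I.IsPrime›).1 hle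
  rw [Finset.mem_erase, Set.Finite.mem_toFinset] at hq
  exact hq.1 (le_antisymm hqI (hI.2 hq.2.1 hqI))

theorem le_add_card_of_mem_minimalPrimes {T : Finset (MvPolynomial (Fin d) ℂ)}
    (hI : I ∈ (Ideal.span (T : Set (MvPolynomial (Fin d) ℂ))).minimalPrimes)
    (hintegral : ((Ideal.Quotient.mk I).comp
      (aeval φ : MvPolynomial (Fin s) ℂ →ₐ[ℂ] _).toRingHom).IsIntegral) :
    d ≤ T.card + s := by
  classical
  have hprime := hI.1.1
  obtain ⟨h, hhI, hh⟩ := Ideal.exists_mem_of_mem_minimalPrimes hI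
  obtain ⟨z, hz, hzh⟩ : ∃ z ∈ zeroLocus ℂ I, eval z h ≠ 0 := by
    by_contra! hcon
    refine hhI ?_
    rw [← IsPrime.vanishingIdeal_zeroLocus (K := ℂ) I]
    exact hcon
  let ψ : Fin s → MvPolynomial (Fin d) ℂ := fun i => φ i - C (eval z (φ i))
  let T' := T ∪ Finset.univ.image ψ
  have hIm : I ≤ vanishingIdeal ℂ {z} := fun p hp => by
    rw [mem_vanishingIdeal_singleton_iff]
    exact hz p hp
  have hm : vanishingIdeal ℂ {z} ∈
      (Ideal.span (T' : Set (MvPolynomial (Fin d) ℂ))).minimalPrimes := by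
    refine ⟨⟨inferInstance, Ideal.span_le.2 ?_⟩, ?_⟩
    · intro p hp
      rcases Finset.mem_union.1 (Finset.mem_coe.1 hp) with hp | hp
      · exact hIm (hI.1.2 (Ideal.subset_span hp))
      · obtain ⟨i, -, rfl⟩ := Finset.mem_image.1 hp
        rw [SetLike.mem_coe, mem_vanishingIdeal_singleton_iff]
        simp [ψ]
    · rintro q ⟨hq, hTq⟩ hqm
      obtain ⟨q', hq', hq'q⟩ := Ideal.exists_minimalPrimes_le (I := Ideal.span (T : Set _)) (J := q)
        ((Ideal.span_mono (by simp [T'])).trans hTq)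
      have hIq : I ≤ q := by
        by_cases heq : q' = I
        · exact heq ▸ hq'q
        · refine absurd (hqm (hq'q (hh q' hq' heq))) fun hmem => hzh ?_
          exact (mem_vanishingIdeal_singleton_iff _ _).1 hmem
      have hker : RingHom.ker (Ideal.Quotient.mk I) ≤ q := by rwa [Ideal.mk_ker]
      have hqp : (q.map (Ideal.Quotient.mk I)).IsPrime :=
        Ideal.map_isPrime_of_surjective Ideal.Quotient.mk_surjective hker
      have hcomap : (q.map (Ideal.Quotient.mk I)).comap (Ideal.Quotient.mk I) = q := by
        rw [Ideal.comap_map_of_surjective' _ Ideal.Quotient.mk_surjective]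
        exact sup_eq_left.2 hker
      have hmax : (q.map (Ideal.Quotient.mk I)).IsMaximal := by
        refine Ideal.isMaximal_of_isIntegral_of_isMaximal_comap' _ hintegral _ ?_
        rw [eq_vanishingIdeal_singleton (y := fun i => eval z (φ i)) (Ideal.comap_ne_top _ hqp.ne_top)
          fun i => ?_]
        · infer_instance
        · rw [Ideal.mem_comap, RingHom.comp_apply, ← Ideal.mem_comap, hcomap]
          have : ψ i ∈ q := hTq (Ideal.subset_span (by simp [T']))
          simpa [ψ] using this
      have hqmax : q.IsMaximal := by
        rw [← hcomap]
        exact Ideal.comap_isMaximal_of_surjective _ Ideal.Quotient.mk_surjective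
      exact (hqmax.eq_of_le (Ideal.IsPrime.ne_top inferInstance) hqm).ge
  have h1 := (le_height_of_isMaximal (vanishingIdeal ℂ {z})).trans
    (Ideal.height_le_card_of_mem_minimalPrimes_span_finset hm)
  have h2 : T'.card ≤ T.card + s := (Finset.card_union_le _ _).trans
    (by gcongr; exact Finset.card_image_le.trans (by simp))
  exact (by exact_mod_cast h1 : d ≤ T'.card).trans h2

theorem le_dimH_zeroLocus_of_mem_minimalPrimes {T : Finset (MvPolynomial (Fin d) ℂ)}
    (hI : I ∈ (Ideal.span (T : Set (MvPolynomial (Fin d) ℂ))).minimalPrimes) :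
    2 * ((d - T.card : ℕ) : ENNReal) ≤ dimH (zeroLocus ℂ I) := by
  have hprime := hI.1.1
  obtain ⟨s, g, hg, hgi⟩ := exists_integral_inj_algHom_of_fg ℂ (MvPolynomial (Fin d) ℂ ⧸ I)
  choose φ hφ using fun i => Ideal.Quotient.mk_surjective (I := I) (g (X i))
  have heq : g = (Ideal.Quotient.mkₐ ℂ I).comp (aeval φ) := by
    ext i
    simp [hφ]
  have hintegral : ((Ideal.Quotient.mk I).comp
      (aeval φ : MvPolynomial (Fin s) ℂ →ₐ[ℂ] _).toRingHom).IsIntegral := by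
    rw [heq] at hgi
    exact hgi
  refine le_trans ?_ (two_mul_le_dimH_zeroLocus (φ := φ) (fun p hp => ?_) hintegral)
  · have := le_add_card_of_mem_minimalPrimes hI hintegral
    gcongr
    omega
  · refine (map_eq_zero_iff g hg).1 ?_
    rw [heq]
    exact Ideal.Quotient.eq_zero_iff_mem.2 hp
end

section

open MvPolynomial

theorem isIrreducibleVariety_zeroLocus {n : ℕ} (J : Ideal (MvPolynomial (Fin n) ℂ)) [J.IsPrime] :
    IsIrreducibleVariety ℂ (zeroLocus ℂ J) := by
  have hJ : vanishingIdeal ℂ (zeroLocus ℂ J) = J := IsPrime.vanishingIdeal_zeroLocus J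
  refine ⟨⟨J, rfl⟩, ?_, ?_⟩
  · rw [Set.nonempty_iff_ne_empty]
    intro h
    rw [h, vanishingIdeal_empty] at hJ
    exact Ideal.IsPrime.ne_top ‹_› hJ.symm
  · rintro V₁ V₂ ⟨F₁, rfl⟩ ⟨F₂, rfl⟩ hV
    by_contra! hcon
    obtain ⟨h₁, h₂⟩ := hcon
    obtain ⟨x, hx, hx'⟩ := Set.not_subset.1 h₁
    obtain ⟨y, hy, hy'⟩ := Set.not_subset.1 h₂
    simp only [Set.mem_ofPred_eq, not_forall] at hx' hy'
    obtain ⟨f, hf, hfx⟩ := hx'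
    obtain ⟨g, hg, hgy⟩ := hy'
    have hfg : f * g ∈ J := by
      rw [← hJ]
      intro z hz
      rw [map_mul]
      rcases hV hz with h | h
      · exact mul_eq_zero_of_left (h f hf) _
      · exact mul_eq_zero_of_right _ (h g hg)
    rcases Ideal.IsPrime.mem_or_mem ‹_› hfg with h | h
    · exact hfx (hx f h)
    · exact hgy (hy g h)

theorem IsIrreducibleComponent.exists_mem_minimalPrimes {n : ℕ}
    {T : Set (MvPolynomial (Fin n) ℂ)} {W : Set (Fin n → ℂ)}
    (hW : IsIrreducibleComponent ℂ (zeroLocus ℂ (Ideal.span T)) W) :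
    ∃ I ∈ (Ideal.span T).minimalPrimes, W = zeroLocus ℂ I := by
  obtain ⟨⟨⟨F, hF⟩, hne, hirr⟩, hWV, hmax⟩ := hW
  have hWI : W = zeroLocus ℂ (vanishingIdeal ℂ W) := by
    refine Set.Subset.antisymm (zeroLocus_vanishingIdeal_le W) fun x hx => ?_
    rw [hF]
    intro f hf
    refine hx f fun y hy => ?_
    rw [hF] at hy
    exact hy f hf
  have hprime : (vanishingIdeal ℂ W).IsPrime := by
    refine Ideal.isPrime_iff.2 ⟨fun h => ?_, fun {f g} hfg => ?_⟩
    · obtain ⟨x, hx⟩ := hne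
      have h1 : (1 : MvPolynomial (Fin n) ℂ) ∈ vanishingIdeal ℂ W := by rw [h]; trivial
      exact one_ne_zero ((map_one (aeval x)).symm.trans (h1 x hx))
    · refine (hirr {x | ∀ p ∈ ({f} : Set _), eval x p = 0} {x | ∀ p ∈ ({g} : Set _), eval x p = 0}
        ⟨_, rfl⟩ ⟨_, rfl⟩ fun x hx => ?_).imp (fun h x hx => h hx f rfl) (fun h x hx => h hx g rfl)
      have := hfg x hx
      rw [map_mul, mul_eq_zero] at this
      exact this.imp (fun h p hp => by rw [hp]; exact h) (fun h p hp => by rw [hp]; exact h)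
  refine ⟨vanishingIdeal ℂ W, ⟨⟨hprime, le_zeroLocus_iff_le_vanishingIdeal.1 hWV⟩, ?_⟩, hWI⟩
  rintro J ⟨hJ, hTJ⟩ hJW
  have h : zeroLocus ℂ J = W := hmax _ (isIrreducibleVariety_zeroLocus J)
    (le_zeroLocus_iff_le_vanishingIdeal.2 hJW) (zeroLocus_anti_mono hTJ)
  rw [← h]
  exact (IsPrime.vanishingIdeal_zeroLocus J).le

theorem not_dvd_of_dimH_inter_lt {n : ℕ} {P Q : MvPolynomial (Fin n) ℝ}
    (hP : Irreducible P) (hPreal : IsRealIdeal (Ideal.span {P}))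
    (hdim : dimH ({x : Fin n → ℝ | eval x P = 0} ∩ {x : Fin n → ℝ | eval x Q = 0}) <
      ((n - 1 : ℕ) : ENNReal)) : ¬ P ∣ Q := by
  rintro ⟨R, rfl⟩
  refine absurd (le_dimH_zeros_of_isRealIdeal hP hPreal) (not_le.2 ?_)
  rwa [Set.inter_eq_left.2] at hdim
  intro x hx
  simp only [Set.mem_ofPred_eq] at hx ⊢
  rw [map_mul, hx, zero_mul]

end

/-- If `P, Q ∈ ℝ[x₁,…,x_d]` are irreducible polynomials generating real ideals
and the real intersection `Z(P) ∩ Z(Q)` has dimension `d - 2` (as Hausdorff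
dimension), then `Z(P)* ∩ Z(Q)*` is a complete intersection: every irreducible
component of `Z(P)* ∩ Z(Q)*` has complex dimension `d - 2`, i.e. Hausdorff
dimension `2(d-2)`. -/
theorem stmt_15 (d : ℕ) (hd : 2 ≤ d) (P Q : MvPolynomial (Fin d) ℝ)
    (hP : Irreducible P) (hQ : Irreducible Q)
    (hPreal : IsRealIdeal (Ideal.span {P})) (hQreal : IsRealIdeal (Ideal.span {Q}))
    (hdim : dimH ({x : Fin d → ℝ | eval x P = 0} ∩ {x : Fin d → ℝ | eval x Q = 0}) =
      (d : ENNReal) - 2) :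
    ∀ W : Set (Fin d → ℂ),
      IsIrreducibleComponent ℂ
        (complexification {x : Fin d → ℝ | eval x P = 0} ∩
          complexification {x : Fin d → ℝ | eval x Q = 0}) W →
      dimH W = 2 * ((d : ENNReal) - 2) := by
  classical
  intro W hW
  have hcast : (d : ENNReal) - 2 = ((d - 2 : ℕ) : ENNReal) := by push_cast; rfl
  have hPQ : ¬ P ∣ Q := not_dvd_of_dimH_inter_lt hP hPreal (by
    rw [hdim, hcast]
    exact_mod_cast (by omega : d - 2 < d - 1))
  let T : Finset (MvPolynomial (Fin d) ℂ) :=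
    {MvPolynomial.map Complex.ofRealHom P, MvPolynomial.map Complex.ofRealHom Q}
  have hV : complexification {x : Fin d → ℝ | eval x P = 0} ∩
      complexification {x : Fin d → ℝ | eval x Q = 0} =
        zeroLocus ℂ (Ideal.span (T : Set (MvPolynomial (Fin d) ℂ))) := by
    rw [complexification_zeros hP hPreal, complexification_zeros hQ hQreal, zeroLocus_span]
    ext z
    simp [T]
  rw [hV] at hW
  obtain ⟨I, hI, rfl⟩ := hW.exists_mem_minimalPrimes
  have hTI : ∀ p ∈ T, p ∈ I := fun p hp => hI.1.2 (Ideal.subset_span hp)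
  rw [hcast]
  refine le_antisymm (dimH_zeroLocus_le _ I fun S hS => card_le_of_indepModulo hP hPQ
    (hTI _ (by simp [T])) (hTI _ (by simp [T])) S hS) (le_trans ?_
      (le_dimH_zeroLocus_of_mem_minimalPrimes hI))
  have := Finset.card_le_two (a := MvPolynomial.map Complex.ofRealHom P)
    (b := MvPolynomial.map Complex.ofRealHom Q)
  gcongr
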